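/- Every unit disk graph G with maximum degree Δ contains a grid of size ⌊tw(G)/(100Δ³)⌋ × ⌊tw(G)/(100Δ³)⌋ as a minor. -/

import Mathlib

open SimpleGraph Set Metric

/-- `G` has a tree decomposition of width at most `k`. -/
def SimpleGraph.TreewidthLE {V : Type} (G : SimpleGraph V) (k : ℕ) : Prop :=
  ∃ (ι : Type) (T : SimpleGraph ι) (bag : ι → Set V),
    T.IsTree ∧
    (∀ v : V, ∃ i, v ∈ bag i) ∧
    (∀ u w : V, G.Adj u w → ∃ i, u ∈ bag i ∧ w ∈ bag i) ∧
    (∀ v : V, (T.induce {i | v ∈ bag i}).Connected) ∧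
    (∀ i, (bag i).Finite ∧ (bag i).ncard ≤ k + 1)

/-- The treewidth of a graph: the least width of a tree decomposition. -/
noncomputable def SimpleGraph.treewidth {V : Type} (G : SimpleGraph V) : ℕ :=
  sInf {k | G.TreewidthLE k}

/-- `H` is a minor of `G`, witnessed by a family of pairwise disjoint connected branch
sets, one for each vertex of `H`, with an edge of `G` between the branch sets of any
two vertices adjacent in `H`. -/
def SimpleGraph.IsMinorOf {W V : Type} (H : SimpleGraph W) (G : SimpleGraph V) : Prop :=
  ∃ φ : W → Set V,
    (∀ w, (G.induce (φ w)).Connected) ∧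
    (∀ w₁ w₂, w₁ ≠ w₂ → Disjoint (φ w₁) (φ w₂)) ∧
    (∀ w₁ w₂, H.Adj w₁ w₂ → ∃ u ∈ φ w₁, ∃ v ∈ φ w₂, G.Adj u v)

/-- The `r × r` grid graph: the Cartesian (box) product of two paths on `r` vertices. -/
def gridGraph (r : ℕ) : SimpleGraph (Fin r × Fin r) :=
  (SimpleGraph.pathGraph r).boxProd (SimpleGraph.pathGraph r)

/-- The Euclidean plane. -/
abbrev Plane : Type := EuclideanSpace ℝ (Fin 2)

/-- `c` assigns to the vertices of `G` centers of closed unit disks realizing `G` as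
their intersection graph: two distinct vertices are adjacent iff the corresponding unit
disks intersect, i.e. iff their centers are at distance at most `2`. -/
def IsUnitDiskRealization {V : Type} (G : SimpleGraph V) (c : V → Plane) : Prop :=
  ∀ u v : V, G.Adj u v ↔ u ≠ v ∧ dist (c u) (c v) ≤ 2

/-- `G` is a unit disk graph. -/
def IsUnitDiskGraph {V : Type} (G : SimpleGraph V) : Prop :=
  ∃ c : V → Plane, IsUnitDiskRealization G c

namespace UDG

/-- There is a walk of `H` from `u` to `v` inside the vertex set `C`. -/
def Linked {V : Type} (H : SimpleGraph V) (C : Set V) (u v : V) : Prop :=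
  ∃ p : H.Walk u v, ∀ x ∈ p.support, x ∈ C

/-- `(A, B)` is a separation of `H`. -/
def IsSep {V : Type} (H : SimpleGraph V) (A B : Set V) : Prop :=
  (∀ v, v ∈ A ∨ v ∈ B) ∧ ∀ u v, H.Adj u v → (u ∈ A ∧ v ∈ A) ∨ (u ∈ B ∧ v ∈ B)

/-- There are `k` disjoint vertex sets, each of which links `S` to `T`. -/
def HasLinkage {V : Type} (H : SimpleGraph V) (S T : Set V) (k : ℕ) : Prop :=
  ∃ P : Fin k → Set V, (∀ i j, i ≠ j → Disjoint (P i) (P j)) ∧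
    ∀ i, ∃ a ∈ S, ∃ b ∈ T, Linked H (P i) a b

section
variable {V : Type} {H H' : SimpleGraph V} {C D : Set V} {u v w : V}

theorem Linked.refl (hu : u ∈ C) : Linked H C u u := ⟨Walk.nil, by simpa using hu⟩

theorem Linked.mono (h : Linked H C u v) (hCD : C ⊆ D) : Linked H D u v :=
  let ⟨p, hp⟩ := h; ⟨p, fun x hx => hCD (hp x hx)⟩

theorem Linked.mono_graph (h : Linked H C u v) (hH : H ≤ H') : Linked H' C u v :=
  let ⟨p, hp⟩ := h; ⟨p.mapLe hH, by simpa using hp⟩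

theorem Linked.symm (h : Linked H C u v) : Linked H C v u :=
  let ⟨p, hp⟩ := h; ⟨p.reverse, by simpa using hp⟩

theorem Linked.trans (h : Linked H C u v) (h' : Linked H C v w) : Linked H C u w := by
  obtain ⟨p, hp⟩ := h
  obtain ⟨q, hq⟩ := h'
  refine ⟨p.append q, fun x hx => ?_⟩
  rcases (Walk.mem_support_append_iff p q).1 hx with h | h
  exacts [hp x h, hq x h]

theorem Linked.left_mem (h : Linked H C u v) : u ∈ C :=
  let ⟨p, hp⟩ := h; hp _ p.start_mem_support

theorem Linked.right_mem (h : Linked H C u v) : v ∈ C := h.symm.left_mem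

theorem Linked.of_adj (h : H.Adj u v) (hu : u ∈ C) (hv : v ∈ C) : Linked H C u v :=
  ⟨Walk.cons h Walk.nil, by simp [hu, hv]⟩

/-- A connection to `b` starting in `A` and meeting `A ∩ B` at most in `b` stays in `A`. -/
theorem Linked.inter_left {A B : Set V} (hs : IsSep H A B) {b : V}
    (h : Linked H C u b) (hu : u ∈ A) (hb : b ∈ A)
    (hC : ∀ z ∈ C, z ∈ A → z ∈ B → z = b) : Linked H (C ∩ A) u b := by
  obtain ⟨p, hp⟩ := h
  induction p with
  | nil => exact Linked.refl ⟨hp _ (by simp), hu⟩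
  | @cons u v b huv p ih =>
    have huC : u ∈ C := hp u (by simp)
    by_cases hub : u = b
    · subst hub; exact Linked.refl ⟨huC, hu⟩
    · have hv : v ∈ A := by
        rcases hs.2 u v huv with h | h
        · exact h.2
        · exact absurd (hC u huC hu h.1) hub
      have hl := ih hv hb hC (fun x hx => hp x (by simp [hx]))
      exact Linked.trans (Linked.of_adj huv ⟨huC, hu⟩ hl.left_mem) hl

theorem IsSep.symm {A B : Set V} (h : IsSep H A B) : IsSep H B A :=
  ⟨fun v => (h.1 v).symm, fun u v huv => (h.2 u v huv).symm⟩

theorem Linked.exists_path (h : Linked H C u v) :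
    ∃ (n : ℕ) (p : ℕ → V), p 0 = u ∧ p n = v ∧ (∀ i < n, H.Adj (p i) (p (i + 1))) ∧
      (∀ i j, i ≤ n → j ≤ n → p i = p j → i = j) ∧ ∀ i ≤ n, p i ∈ C := by
  classical
  obtain ⟨p, hp⟩ := h
  refine ⟨p.bypass.length, p.bypass.getVert, by simp, by simp, fun i hi =>
    p.bypass.adj_getVert_succ hi, fun i j hi hj hij => ?_, fun i _ => ?_⟩
  · exact (p.bypass_isPath).getVert_injOn hi hj hij
  · exact hp _ (p.support_bypass_subset_support (p.bypass.getVert_mem_support i))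

set_option maxHeartbeats 2000000 in
/-- Menger theorem for vertex sets in a finite graph. -/
theorem menger [Finite V] (k : ℕ) (H : SimpleGraph V) (S T : Set V) :
    HasLinkage H S T k ∨
      ∃ A B, IsSep H A B ∧ S ⊆ A ∧ T ⊆ B ∧ (A ∩ B).ncard < k := by
  classical
  induction hn : H.edgeSet.ncard using Nat.strong_induction_on generalizing H S T with
  | _ n ih =>
  by_cases hE : ∃ x y, H.Adj x y
  swap
  · push Not at hE
    by_cases hk : k ≤ (S ∩ T).ncard
    · left
      obtain ⟨R, hR, hRk⟩ := Set.exists_subset_card_eq hk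
      have : Nonempty (Fin k ≃ R) := by
        rw [← hRk]
        exact ⟨(Finite.equivFinOfCardEq rfl).symm⟩
      obtain ⟨e⟩ := this
      refine ⟨fun i => {(e i : V)}, fun i j hij => ?_, fun i =>
        ⟨e i, (hR (e i).2).1, e i, (hR (e i).2).2, Linked.refl rfl⟩⟩
      simp only [disjoint_singleton, ne_eq]
      exact fun h => hij (e.injective (Subtype.ext h))
    · right
      refine ⟨S, Sᶜ ∪ (S ∩ T), ⟨fun v => ?_, fun u v h => absurd h (hE u v)⟩, le_rfl,
        fun v hv => ?_, ?_⟩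
      · by_cases h : v ∈ S <;> simp [h]
      · by_cases h : v ∈ S <;> simp [h, hv]
      · have : S ∩ (Sᶜ ∪ (S ∩ T)) = S ∩ T := by ext; simp; tauto
        rw [this]; omega
  obtain ⟨x, y, hxy⟩ := hE
  set H' := H.deleteEdges {s(x, y)} with hH'
  have hle : H' ≤ H := H.deleteEdges_le _
  have hcard : H'.edgeSet.ncard < n := by
    rw [← hn]
    apply Set.ncard_lt_ncard _ (Set.toFinite _)
    refine ⟨edgeSet_mono hle, fun h => ?_⟩
    have := h (show s(x, y) ∈ H.edgeSet from hxy)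
    simp [hH'] at this
  have hadj : ∀ u v, H.Adj u v → H'.Adj u v ∨ (u = x ∧ v = y) ∨ (u = y ∧ v = x) := by
    intro u v huv
    simp only [hH', deleteEdges_adj, mem_singleton_iff, Sym2.eq_iff]
    tauto
  have lift : ∀ A B, IsSep H' A B → (x ∈ A ∧ y ∈ A) ∨ (x ∈ B ∧ y ∈ B) → IsSep H A B := by
    intro A B hs h
    refine ⟨hs.1, fun u v huv => ?_⟩
    rcases hadj u v huv with h' | ⟨rfl, rfl⟩ | ⟨rfl, rfl⟩
    · exact hs.2 u v h'
    · exact h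
    · tauto
  rcases ih _ hcard H' S T rfl with h | ⟨A, B, hs, hSA, hTB, hk⟩
  · left
    obtain ⟨P, hd, hP⟩ := h
    refine ⟨P, hd, fun i => ?_⟩
    obtain ⟨a, ha, b, hb, hl⟩ := hP i
    exact ⟨a, ha, b, hb, hl.mono_graph hle⟩
  by_cases hin : (x ∈ A ∧ y ∈ A) ∨ (x ∈ B ∧ y ∈ B)
  · exact Or.inr ⟨A, B, lift A B hs hin, hSA, hTB, hk⟩
  -- orient the deleted edge from `A` to `B`
  obtain ⟨x, y, hxy, hadj, lift, hxA, hxB, hyA, hyB⟩ : ∃ x y, H.Adj x y ∧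
      (∀ u v, H.Adj u v → H'.Adj u v ∨ (u = x ∧ v = y) ∨ (u = y ∧ v = x)) ∧
      (∀ A B, IsSep H' A B → (x ∈ A ∧ y ∈ A) ∨ (x ∈ B ∧ y ∈ B) → IsSep H A B) ∧
      x ∈ A ∧ x ∉ B ∧ y ∉ A ∧ y ∈ B := by
    have h1 := hs.1 x
    have h2 := hs.1 y
    by_cases hxA : x ∈ A
    · exact ⟨x, y, hxy, hadj, lift, by tauto⟩
    · refine ⟨y, x, hxy.symm, fun u v huv => ?_, fun A B h h' => lift A B h ?_, by tauto⟩
      · have := hadj u v huv; tauto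
      · tauto
  clear hin
  have hZx : (insert x (A ∩ B)).ncard = (A ∩ B).ncard + 1 :=
    Set.ncard_insert_of_notMem (by simp [hxB]) (Set.toFinite _)
  have hZy : (insert y (A ∩ B)).ncard = (A ∩ B).ncard + 1 :=
    Set.ncard_insert_of_notMem (by simp [hyA]) (Set.toFinite _)
  by_cases hlt : (A ∩ B).ncard + 1 < k
  · right
    refine ⟨insert y A, B, lift _ _ ⟨fun v => ?_, fun u v huv => ?_⟩ (by simp [hxA]),
      hSA.trans (subset_insert _ _), hTB, ?_⟩
    · rcases hs.1 v with h | h <;> simp [h]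
    · rcases hs.2 u v huv with h | h <;> simp [h]
    · rw [Set.insert_inter_of_mem hyB]
      omega
  have hkZ : k = (A ∩ B).ncard + 1 := by omega
  rcases ih _ hcard H' S (insert x (A ∩ B)) rfl with h1 | ⟨C, D, hCD, hSC, hZD, hk1⟩
  swap
  · right
    refine ⟨C ∩ A, D ∪ B, lift _ _ ⟨fun v => ?_, fun u v huv => ?_⟩ ?_, subset_inter hSC hSA,
      hTB.trans subset_union_right, lt_of_le_of_lt (Set.ncard_le_ncard ?_ (Set.toFinite _)) hk1⟩
    · have := hs.1 v; have := hCD.1 v; simp; tauto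
    · have h1 := hs.2 u v huv
      have h2 := hCD.2 u v huv
      have hu : u ∈ A → u ∈ B → u ∈ D := fun h h' => hZD (by simp [h, h'])
      have hv : v ∈ A → v ∈ B → v ∈ D := fun h h' => hZD (by simp [h, h'])
      simp only [mem_inter_iff, mem_union]
      tauto
    · right; exact ⟨Or.inl (hZD (by simp)), Or.inr hyB⟩
    · rintro z ⟨⟨h1, h2⟩, h3 | h3⟩
      · exact ⟨h1, h3⟩
      · exact ⟨h1, hZD (by simp [h2, h3])⟩
  rcases ih _ hcard H' (insert y (A ∩ B)) T rfl with h2 | ⟨C, D, hCD, hZC, hTD, hk1⟩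
  swap
  · right
    refine ⟨A ∪ C, B ∩ D, lift _ _ ⟨fun v => ?_, fun u v huv => ?_⟩ ?_,
      hSA.trans subset_union_left, subset_inter hTB hTD,
      lt_of_le_of_lt (Set.ncard_le_ncard ?_ (Set.toFinite _)) hk1⟩
    · have := hs.1 v; have := hCD.1 v; simp; tauto
    · have h1 := hs.2 u v huv
      have h2 := hCD.2 u v huv
      have hu : u ∈ A → u ∈ B → u ∈ C := fun h h' => hZC (by simp [h, h'])
      have hv : v ∈ A → v ∈ B → v ∈ C := fun h h' => hZC (by simp [h, h'])
      simp only [mem_inter_iff, mem_union]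
      tauto
    · left; exact ⟨Or.inl hxA, Or.inr (hZC (by simp))⟩
    · rintro z ⟨h3 | h3, h1, h2⟩
      · exact ⟨hZC (by simp [h1, h3]), h2⟩
      · exact ⟨h3, h2⟩
  left
  obtain ⟨P, hPd, hP⟩ := h1
  obtain ⟨Q, hQd, hQ⟩ := h2
  choose a ha b hb hab using hP
  choose c hc d hd hcd using hQ
  have hbP : ∀ i, b i ∈ P i := fun i => (hab i).right_mem
  have hcQ : ∀ i, c i ∈ Q i := fun i => (hcd i).left_mem
  have surj : ∀ (Z : Set V) (R : Fin k → Set V) (f : Fin k → V),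
      (∀ i j, i ≠ j → Disjoint (R i) (R j)) → (∀ i, f i ∈ R i) → (∀ i, f i ∈ Z) →
      Z.ncard = k → ∀ z ∈ Z, ∃ i, f i = z := by
    intro Z R f hR hf hfZ hZ z hz
    have hinj : Function.Injective f := fun i j hij => by
      by_contra hne
      exact Set.disjoint_left.1 (hR i j hne) (hf i) (hij ▸ hf j)
    have : Set.range f = Z := by
      apply Set.eq_of_subset_of_ncard_le (by rintro _ ⟨i, rfl⟩; exact hfZ i) _ (Set.toFinite _)
      rw [hZ, ← Set.image_univ, Set.ncard_image_of_injective _ hinj, Set.ncard_univ,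
        Nat.card_eq_fintype_card, Fintype.card_fin]
    rw [← this] at hz
    exact hz
  have sP := surj _ P b hPd hbP hb (by omega)
  have sQ := surj _ Q c hQd hcQ hc (by omega)
  have uP : ∀ i, ∀ z ∈ P i, z ∈ insert x (A ∩ B) → z = b i := by
    intro i z hz hzZ
    obtain ⟨j, rfl⟩ := sP z hzZ
    by_contra hne
    exact Set.disjoint_left.1 (hPd i j (by rintro rfl; exact hne rfl)) hz (hbP j)
  have uQ : ∀ i, ∀ z ∈ Q i, z ∈ insert y (A ∩ B) → z = c i := by
    intro i z hz hzZ
    obtain ⟨j, rfl⟩ := sQ z hzZ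
    by_contra hne
    exact Set.disjoint_left.1 (hQd i j (by rintro rfl; exact hne rfl)) hz (hcQ j)
  have bA : ∀ i, b i ∈ A := fun i => by
    rcases hb i with h | h
    · rw [h]; exact hxA
    · exact h.1
  have cB : ∀ i, c i ∈ B := fun i => by
    rcases hc i with h | h
    · rw [h]; exact hyB
    · exact h.2
  have lP : ∀ i, Linked H (P i ∩ A) (a i) (b i) := fun i =>
    ((hab i).inter_left hs (hSA (ha i)) (bA i)
      (fun z hz h1 h2 => uP i z hz (Or.inr ⟨h1, h2⟩))).mono_graph hle
  have lQ : ∀ i, Linked H (Q i ∩ B) (c i) (d i) := fun i =>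
    (((hcd i).symm.inter_left hs.symm (hTB (hd i)) (cB i)
      (fun z hz h1 h2 => uQ i z hz (Or.inr ⟨h2, h1⟩))).mono_graph hle).symm
  let f : V → V := fun z => if z = x then y else z
  have hf : ∀ i, ∃ j, c j = f (b i) := fun i => by
    apply sQ
    by_cases h : b i = x
    · simp [f, h]
    · have := hb i
      simp only [f, h, if_false]
      exact Or.inr (this.resolve_left h)
  choose π hπ using hf
  refine ⟨fun i => (P i ∩ A) ∪ (Q (π i) ∩ B), fun i j hij => ?_, fun i => ⟨a i, ha i, d (π i),
    hd _, ?_⟩⟩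
  · have key : ∀ i j, i ≠ j → ∀ z, z ∈ P i → z ∈ A → z ∈ Q (π j) → z ∈ B → False := by
      intro i j hij z h1 h2 h3 h4
      have e1 := uP i z h1 (Or.inr ⟨h2, h4⟩)
      have e2 := uQ _ z h3 (Or.inr ⟨h2, h4⟩)
      rw [hπ j] at e2
      by_cases h : b j = x
      · simp only [f, h, if_true] at e2
        exact hyA (e2 ▸ h2)
      · simp only [f, h, if_false] at e2
        exact Set.disjoint_left.1 (hPd i j hij) h1 (e2 ▸ hbP j)
    have hπinj : π i ≠ π j := by
      intro h
      have h1 := hπ i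
      rw [h, hπ j] at h1
      have hne : b i ≠ b j := fun h' => Set.disjoint_left.1 (hPd i j hij) (hbP i) (h' ▸ hbP j)
      by_cases hi : b i = x <;> by_cases hj : b j = x
      · exact hne (hi.trans hj.symm)
      · simp only [f, hi, hj, if_true, if_false] at h1
        exact hyA (h1 ▸ bA j)
      · simp only [f, hi, hj, if_true, if_false] at h1
        exact hyA (h1 ▸ bA i)
      · simp only [f, hi, hj, if_false] at h1
        exact hne h1.symm
    rw [Set.disjoint_left]
    rintro z (⟨h1, h2⟩ | ⟨h1, h2⟩) (⟨h3, h4⟩ | ⟨h3, h4⟩)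
    · exact Set.disjoint_left.1 (hPd i j hij) h1 h3
    · exact key i j hij z h1 h2 h3 h4
    · exact key j i hij.symm z h3 h4 h1 h2
    · exact Set.disjoint_left.1 (hQd _ _ hπinj) h1 h3
  · have l1 := (lP i).mono (subset_union_left (t := Q (π i) ∩ B))
    have l2 := (lQ (π i)).mono (subset_union_right (s := P i ∩ A))
    refine l1.trans (Linked.trans ?_ l2)
    by_cases h : b i = x
    · refine Linked.of_adj ?_ l1.right_mem l2.left_mem
      rw [hπ i]; simpa [f, h] using hxy
    · have : c (π i) = b i := by rw [hπ i]; simp [f, h]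
      rw [this]; exact Linked.refl l1.right_mem

end
section
variable {V : Type}

theorem connected_induce_iff (H : SimpleGraph V) (C : Set V) :
    (H.induce C).Connected ↔ C.Nonempty ∧ ∀ u ∈ C, ∀ v ∈ C, Linked H C u v := by
  constructor
  · intro h
    have := h.nonempty
    refine ⟨Set.nonempty_coe_sort.1 this, fun u hu v hv => ?_⟩
    obtain ⟨p⟩ := h.preconnected ⟨u, hu⟩ ⟨v, hv⟩
    refine ⟨p.map (Embedding.induce C).toHom, fun x hx => ?_⟩
    erw [Walk.support_map] at hx
    obtain ⟨y, -, rfl⟩ := List.mem_map.1 hx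
    exact y.2
  · rintro ⟨hne, h⟩
    have := Set.nonempty_coe_sort.2 hne
    refine ⟨fun u v => ?_⟩
    obtain ⟨p, hp⟩ := h u u.2 v v.2
    exact ⟨p.induce C hp⟩

/-- A tree decomposition of `H[U]` with bags of size at most `b`, given by a parent function,
whose root bag contains `W`. -/
def RootedDec (H : SimpleGraph V) (U W : Set V) (b : ℕ) : Prop :=
  ∃ (ι : Type) (_ : Finite ι) (par : ι → ι) (ht : ι → ℕ) (root : ι) (bag : ι → Set V),
    (∀ i, i ≠ root → ht (par i) < ht i) ∧ W ⊆ bag root ∧ (∀ i, bag i ⊆ U) ∧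
    (∀ u ∈ U, ∀ v ∈ U, H.Adj u v → ∃ i, u ∈ bag i ∧ v ∈ bag i) ∧
    (∀ v ∈ U, ∃ top, v ∈ bag top ∧ ∀ i, v ∈ bag i → i ≠ top → i ≠ root ∧ v ∈ bag (par i)) ∧
    (∀ i, (bag i).ncard ≤ b)

theorem RootedDec.treewidthLE [Finite V] {H : SimpleGraph V} {b : ℕ}
    (h : RootedDec H Set.univ ∅ (b + 1)) : H.TreewidthLE b := by
  classical
  obtain ⟨ι, _, par, ht, root, bag, hpar, -, -, hadj, htop, hb⟩ := h
  let T : SimpleGraph ι := SimpleGraph.fromRel (fun i j => i ≠ root ∧ j = par i)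
  have hT : ∀ i, i ≠ root → T.Adj i (par i) := by
    intro i hi
    rw [SimpleGraph.fromRel_adj]
    refine ⟨fun h => ?_, Or.inl ⟨hi, rfl⟩⟩
    have := hpar i hi
    rw [← h] at this
    exact lt_irrefl _ this
  have hconn : T.Connected := by
    have key : ∀ n i, ht i = n → T.Reachable i root := by
      intro n
      induction n using Nat.strong_induction_on with
      | _ n ih =>
        intro i hi
        by_cases h : i = root
        · rw [h]
        · exact (hT i h).reachable.trans (ih _ (hi ▸ hpar i h) _ rfl)
    have : Nonempty ι := ⟨root⟩
    exact ⟨fun i j => (key _ i rfl).trans (key _ j rfl).symm⟩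
  refine ⟨ι, T, bag, ?_, fun v => ?_, fun u w huw => hadj u trivial w trivial huw, fun v => ?_,
    fun i => ⟨Set.toFinite _, hb i⟩⟩
  · rw [isTree_iff_connected_and_card]
    refine ⟨hconn, le_antisymm ?_ hconn.card_vert_le_card_edgeSet_add_one⟩
    have hsub : T.edgeSet ⊆ (fun i => s(i, par i)) '' {root}ᶜ := by
      intro e
      induction e using Sym2.ind with
      | _ x y =>
        intro hxy
        rw [mem_edgeSet, SimpleGraph.fromRel_adj] at hxy
        rcases hxy.2 with ⟨h, h'⟩ | ⟨h, h'⟩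
        · exact ⟨x, h, by simp [h']⟩
        · exact ⟨y, h, by simp [h', Sym2.eq_swap]⟩
    have h1 : T.edgeSet.ncard ≤ ({root}ᶜ : Set ι).ncard :=
      (Set.ncard_le_ncard hsub (Set.toFinite _)).trans (Set.ncard_image_le (Set.toFinite _))
    have h2 := Set.ncard_add_ncard_compl ({root} : Set ι)
    rw [Set.ncard_singleton] at h2
    rw [Nat.card_coe_set_eq]
    omega
  · obtain ⟨t, ht, -⟩ := htop v trivial
    exact ⟨t, ht⟩
  · obtain ⟨t, htv, htp⟩ := htop v trivial
    rw [connected_induce_iff]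
    have key : ∀ n i, ht i = n → v ∈ bag i → Linked T {i | v ∈ bag i} i t := by
      intro n
      induction n using Nat.strong_induction_on with
      | _ n ih =>
        intro i hi hv
        by_cases h : i = t
        · subst h; exact Linked.refl hv
        · obtain ⟨h1, h2⟩ := htp i hv h
          exact Linked.trans (Linked.of_adj (hT i h1) hv h2) (ih _ (hi ▸ hpar i h1) _ rfl h2)
    exact ⟨⟨t, htv⟩, fun i hi j hj => (key _ i rfl hi).trans (key _ j rfl hj).symm⟩

theorem RootedDec.join {H : SimpleGraph V} {U UA UB R WA WB : Set V} {b : ℕ}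
    (hA : RootedDec H UA WA b) (hB : RootedDec H UB WB b)
    (hUA : UA ⊆ U) (hUB : UB ⊆ U) (hR : R ⊆ U) (hRb : R.ncard ≤ b)
    (hU : ∀ u ∈ U, u ∈ UA ∨ u ∈ UB)
    (hadj : ∀ u ∈ U, ∀ v ∈ U, H.Adj u v → (u ∈ UA ∧ v ∈ UA) ∨ (u ∈ UB ∧ v ∈ UB))
    (hAB : UA ∩ UB ⊆ R) (hRA : R ∩ UA ⊆ WA) (hRB : R ∩ UB ⊆ WB) :
    RootedDec H U R b := by
  classical
  obtain ⟨ι₁, _, p₁, h₁, r₁, g₁, a1, a2, a3, a4, a5, a6⟩ := hA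
  obtain ⟨ι₂, _, p₂, h₂, r₂, g₂, b1, b2, b3, b4, b5, b6⟩ := hB
  let par : Option (ι₁ ⊕ ι₂) → Option (ι₁ ⊕ ι₂)
    | none => none
    | some (Sum.inl i) => if i = r₁ then none else some (Sum.inl (p₁ i))
    | some (Sum.inr i) => if i = r₂ then none else some (Sum.inr (p₂ i))
  let ht : Option (ι₁ ⊕ ι₂) → ℕ
    | none => 0
    | some (Sum.inl i) => h₁ i + 1
    | some (Sum.inr i) => h₂ i + 1
  let bag : Option (ι₁ ⊕ ι₂) → Set V
    | none => R
    | some (Sum.inl i) => g₁ i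
    | some (Sum.inr i) => g₂ i
  refine ⟨Option (ι₁ ⊕ ι₂), inferInstance, par, ht, none, bag, ?_, le_rfl, ?_, ?_, ?_, ?_⟩
  · rintro (_ | i | i) hi
    · exact absurd rfl hi
    · by_cases h : i = r₁
      · simp [par, ht, h]
      · simpa [par, ht, h] using a1 i h
    · by_cases h : i = r₂
      · simp [par, ht, h]
      · simpa [par, ht, h] using b1 i h
  · rintro (_ | i | i)
    exacts [hR, (a3 i).trans hUA, (b3 i).trans hUB]
  · intro u hu v hv huv
    rcases hadj u hu v hv huv with h | h
    · obtain ⟨i, hi⟩ := a4 u h.1 v h.2 huv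
      exact ⟨some (Sum.inl i), hi⟩
    · obtain ⟨i, hi⟩ := b4 u h.1 v h.2 huv
      exact ⟨some (Sum.inr i), hi⟩
  · intro v hv
    by_cases hvR : v ∈ R
    · refine ⟨none, hvR, ?_⟩
      rintro (_ | i | i) hvi hi
      · exact absurd rfl hi
      · refine ⟨by simp, ?_⟩
        have hvU := a3 i hvi
        by_cases h : i = r₁
        · simpa [par, h, bag] using hvR
        · obtain ⟨t, ht, hp⟩ := a5 v hvU
          have htr : r₁ = t := by
            by_contra hne
            exact (hp r₁ (a2 (hRA ⟨hvR, hvU⟩)) hne).1 rfl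
          simpa [par, h, bag] using (hp i hvi (htr ▸ h)).2
      · refine ⟨by simp, ?_⟩
        have hvU := b3 i hvi
        by_cases h : i = r₂
        · simpa [par, h, bag] using hvR
        · obtain ⟨t, ht, hp⟩ := b5 v hvU
          have htr : r₂ = t := by
            by_contra hne
            exact (hp r₂ (b2 (hRB ⟨hvR, hvU⟩)) hne).1 rfl
          simpa [par, h, bag] using (hp i hvi (htr ▸ h)).2
    · rcases hU v hv with hvU | hvU
      · obtain ⟨t, ht, hp⟩ := a5 v hvU
        refine ⟨some (Sum.inl t), ht, ?_⟩
        rintro (_ | i | i) hvi hi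
        · exact absurd hvi hvR
        · obtain ⟨h1, h2⟩ := hp i hvi (fun h => hi (by rw [h]))
          exact ⟨by simp, by simpa [par, h1, bag] using h2⟩
        · exact absurd (hAB ⟨hvU, b3 i hvi⟩) hvR
      · obtain ⟨t, ht, hp⟩ := b5 v hvU
        refine ⟨some (Sum.inr t), ht, ?_⟩
        rintro (_ | i | i) hvi hi
        · exact absurd hvi hvR
        · exact absurd (hAB ⟨a3 i hvi, hvU⟩) hvR
        · obtain ⟨h1, h2⟩ := hp i hvi (fun h => hi (by rw [h]))
          exact ⟨by simp, by simpa [par, h1, bag] using h2⟩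
  · rintro (_ | i | i)
    exacts [hRb, a6 i, b6 i]

theorem RootedDec.mono {H : SimpleGraph V} {U W W' : Set V} {b : ℕ} (h : RootedDec H U W b)
    (hW : W' ⊆ W) : RootedDec H U W' b := by
  obtain ⟨ι, hf, p, ht, r, g, a1, a2, a3⟩ := h
  exact ⟨ι, hf, p, ht, r, g, a1, hW.trans a2, a3⟩

/-- If every `w`-set is split by a small separation then there is a tree decomposition with
small bags. -/
theorem rootedDec_of_forall_exists_sep [Finite V] (H : SimpleGraph V) (k w : ℕ) (hk : 1 ≤ k)
    (hsep : ∀ W : Set V, W.ncard = w → ∃ A B, IsSep H A B ∧ (A ∩ B).ncard ≤ k ∧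
      k ≤ (W \ A).ncard ∧ k ≤ (W \ B).ncard) (U W : Set V) (hWU : W ⊆ U) (hW : W.ncard ≤ w) :
    RootedDec H U W (w + k) := by
  induction hn : U.ncard using Nat.strong_induction_on generalizing U W with
  | _ n ih =>
  by_cases hU : U.ncard ≤ w + k
  · refine ⟨Unit, inferInstance, id, fun _ => 0, (), fun _ => U, by simp, hWU, fun _ => le_rfl,
      fun u hu v hv _ => ⟨(), hu, hv⟩, fun v hv => ⟨(), hv, by simp⟩, fun _ => hU⟩
  obtain ⟨W', hWW', hW'U, hW'⟩ := Set.exists_subsuperset_card_eq hWU hW (by omega)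
  obtain ⟨A, B, hs, hX, hA, hB⟩ := hsep W' hW'
  have small : ∀ C, k ≤ (W' \ C).ncard →
      (W' ∩ C).ncard + k ≤ w ∧ (C ∩ U).ncard < n := by
    intro C hC
    have h1 := Set.ncard_inter_add_ncard_sdiff_eq_ncard W' C (Set.toFinite _)
    refine ⟨by omega, ?_⟩
    rw [← hn]
    apply Set.ncard_lt_ncard _ (Set.toFinite _)
    refine ⟨inter_subset_right, fun h => ?_⟩
    have : (W' \ C) = ∅ := by
      ext x
      simp only [mem_sdiff, mem_empty_iff_false, iff_false, not_and, not_not]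
      exact fun hx => (h (hW'U hx)).1
    rw [this, Set.ncard_empty] at hC
    omega
  have hXU : ((A ∩ B) ∩ U).ncard ≤ k := (Set.ncard_le_ncard inter_subset_left
    (Set.toFinite _)).trans hX
  obtain ⟨sA, sA'⟩ := small A hA
  obtain ⟨sB, sB'⟩ := small B hB
  have dA := ih _ sA' (A ∩ U) ((W' ∩ A) ∪ ((A ∩ B) ∩ U))
    (by
      rintro x (⟨h1, h2⟩ | ⟨⟨h1, h2⟩, h3⟩)
      exacts [⟨h2, hW'U h1⟩, ⟨h1, h3⟩])
    ((Set.ncard_union_le _ _).trans (by omega)) rfl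
  have dB := ih _ sB' (B ∩ U) ((W' ∩ B) ∪ ((A ∩ B) ∩ U))
    (by
      rintro x (⟨h1, h2⟩ | ⟨⟨h1, h2⟩, h3⟩)
      exacts [⟨h2, hW'U h1⟩, ⟨h2, h3⟩])
    ((Set.ncard_union_le _ _).trans (by omega)) rfl
  refine (RootedDec.join (R := W' ∪ ((A ∩ B) ∩ U)) dA dB inter_subset_right inter_subset_right
    (union_subset hW'U inter_subset_right) ((Set.ncard_union_le _ _).trans (by omega))
    (fun u hu => ?_) (fun u hu v hv huv => ?_) ?_ ?_ ?_).mono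
    (hWW'.trans subset_union_left)
  · have := hs.1 u; simp [hu]; exact this
  · have := hs.2 u v huv; simp [hu, hv]; exact this
  · rintro x ⟨⟨h1, h2⟩, h3, -⟩
    exact Or.inr ⟨⟨h1, h3⟩, h2⟩
  · rintro x ⟨h | h, h1, -⟩
    · exact Or.inl ⟨h, h1⟩
    · exact Or.inr h
  · rintro x ⟨h | h, h1, -⟩
    · exact Or.inl ⟨h, h1⟩
    · exact Or.inr h

/-- A tree decomposition of a spanning subgraph that keeps neighbourhoods connected can be
fattened to one of the whole graph. -/
theorem treewidthLE_of_neighbor_linked [Finite V] {G H : SimpleGraph V} {Δ k m : ℕ}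
    (hΔ : ∀ v : V, (G.neighborSet v).ncard ≤ Δ)
    (hloc : ∀ v u, G.Adj v u → Linked H (insert v (G.neighborSet v)) v u)
    (h : H.TreewidthLE k) (hm : (k + 1) * (Δ + 1) ≤ m + 1) : G.TreewidthLE m := by
  obtain ⟨ι, T, bag, hT, hv, he, hc, hb⟩ := h
  have hc' := fun v => ((connected_induce_iff _ _).1 (hc v)).2
  refine ⟨ι, T, fun i => ⋃ x ∈ bag i, insert x (G.neighborSet x), hT, fun v => ?_,
    fun u v huv => ?_, fun v => ?_, fun i => ⟨Set.toFinite _, ?_⟩⟩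
  · obtain ⟨i, hi⟩ := hv v
    exact ⟨i, mem_biUnion hi (by simp)⟩
  · obtain ⟨i, hi⟩ := hv u
    exact ⟨i, mem_biUnion hi (by simp), mem_biUnion hi (by simp [huv])⟩
  · rw [connected_induce_iff]
    set C := {i | v ∈ ⋃ x ∈ bag i, insert x (G.neighborSet x)} with hC
    have hmem : ∀ x ∈ insert v (G.neighborSet v), ∀ i, x ∈ bag i → i ∈ C := by
      intro x hx i hi
      refine mem_biUnion hi ?_
      rcases hx with rfl | hx
      · simp
      · right; exact hx.symm
    have key : ∀ x, Linked H (insert v (G.neighborSet v)) v x → ∀ i j, v ∈ bag i → x ∈ bag j →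
        Linked T C i j := by
      rintro x ⟨p, hp⟩
      suffices ∀ y (p : H.Walk y x), (∀ z ∈ p.support, z ∈ insert v (G.neighborSet v)) →
          ∀ i j, y ∈ bag i → x ∈ bag j → Linked T C i j from this _ p hp
      clear p hp
      intro y p
      induction p with
      | nil =>
        intro hp i j hi hj
        exact (hc' _ i hi j hj).mono (fun l hl => hmem _ (hp _ (by simp)) l hl)
      | @cons a b c hab p ih =>
        intro hp i j hi hj
        obtain ⟨l, hl1, hl2⟩ := he a b hab
        exact ((hc' _ i hi l hl1).mono (fun l hl => hmem _ (hp _ (by simp)) l hl)).trans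
          (ih (fun z hz => hp z (by simp [hz])) l j hl2 hj)
    obtain ⟨t, ht⟩ := hv v
    have hkey : ∀ i ∈ C, Linked T C t i := by
      intro i hi
      obtain ⟨x, hx, hvx⟩ := mem_iUnion₂.1 hi
      rcases hvx with rfl | hvx
      · exact key _ (Linked.refl (by simp)) t i ht hx
      · exact key x (hloc v x hvx.symm) t i ht hx
    exact ⟨⟨t, hmem v (by simp) t ht⟩, fun i hi j hj => (hkey i hi).symm.trans (hkey j hj)⟩
  · have hfin : (bag i).Finite := Set.toFinite _
    have h1 : (⋃ x ∈ bag i, insert x (G.neighborSet x)).ncard ≤ (bag i).ncard * (Δ + 1) := by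
      generalize bag i = S at hfin
      induction S, hfin using Set.Finite.induction_on with
      | empty => simp
      | @insert a S ha hS ih =>
        rw [Set.biUnion_insert, Set.ncard_insert_of_notMem ha hS]
        refine (Set.ncard_union_le _ _).trans ?_
        have := Set.ncard_insert_le a (G.neighborSet a)
        have := hΔ a
        nlinarith
    exact h1.trans ((Nat.mul_le_mul_right _ (hb i).2).trans hm)

end
section
variable {V : Type}

/-- `x, y` are coordinates of a straight-line drawing of `H` without crossings. -/
structure Drawing (H : SimpleGraph V) (x y : V → ℝ) : Prop where
  inj : Function.Injective x
  nc : ∀ u v z w, H.Adj u v → H.Adj z w → v ≠ w → u ≠ w → v ≠ z → ∀ s s' : ℝ,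
    0 ≤ s → s ≤ 1 → 0 ≤ s' → s' ≤ 1 → (1 - s) * x u + s * x v = (1 - s') * x z + s' * x w →
    (1 - s) * y u + s * y v = (1 - s') * y z + s' * y w → u = z ∧ s = 0

/-- The height at abscissa `c` of the line through `u` and `v`. -/
noncomputable def hgt (x y : V → ℝ) (u v : V) (c : ℝ) : ℝ :=
  y u + (y v - y u) * ((c - x u) / (x v - x u))

/-- `c` is in the range of abscissas of the segment `uv`. -/
def InRange (x : V → ℝ) (u v : V) (c : ℝ) : Prop :=
  (x u ≤ c ∧ c ≤ x v) ∨ (x v ≤ c ∧ c ≤ x u)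

open Classical in
/-- Indicator in `ZMod 2` of the segment `uv` passing above the point `(c, h)`. -/
noncomputable def abv (x y : V → ℝ) (u v : V) (c h : ℝ) : ZMod 2 :=
  if ((x u ≤ c ∧ c < x v) ∨ (x v ≤ c ∧ c < x u)) ∧ h < hgt x y u v c then 1 else 0

/-- Parity of the number of edges of a walk above `(c, h)`. -/
noncomputable def par {H : SimpleGraph V} (x y : V → ℝ) (c h : ℝ) :
    ∀ {u v : V}, H.Walk u v → ZMod 2
  | _, _, Walk.nil => 0
  | _, _, @Walk.cons _ _ u v _ _ p => abv x y u v c h + par x y c h p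

variable {H : SimpleGraph V} {x y : V → ℝ}

theorem hgt_left (u v : V) : hgt x y u v (x u) = y u := by simp [hgt]

theorem hgt_right {u v : V} (h : x u ≠ x v) : hgt x y u v (x v) = y v := by
  have : x v - x u ≠ 0 := sub_ne_zero.2 h.symm
  simp [hgt, div_self this]

theorem hgt_symm {u v : V} (h : x u ≠ x v) (c : ℝ) : hgt x y u v c = hgt x y v u c := by
  have h1 : x v - x u ≠ 0 := sub_ne_zero.2 h.symm
  have h2 : x u - x v ≠ 0 := sub_ne_zero.2 h
  unfold hgt
  field_simp
  ring

theorem InRange.symm {u v : V} {c : ℝ} (h : InRange x u v c) : InRange x v u c := Or.symm h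

theorem abv_symm {u v : V} (h : x u ≠ x v) (c b : ℝ) : abv x y u v c b = abv x y v u c b := by
  unfold abv
  rw [hgt_symm h]
  congr 1
  simp only [eq_iff_iff]
  tauto

theorem Drawing.ne (hd : Drawing H x y) {u v : V} (h : H.Adj u v) : x u ≠ x v :=
  fun h' => h.ne (hd.inj h')

theorem Drawing.hgt_ne (hd : Drawing H x y) {u v z w : V} (huv : H.Adj u v) (hzw : H.Adj z w)
    (h1 : v ≠ w) (h2 : u ≠ w) (h3 : v ≠ z) {c : ℝ} (hc : InRange x u v c) (hc' : InRange x z w c)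
    (h : hgt x y u v c = hgt x y z w c) : u = z ∧ x u = c := by
  have aux : ∀ u v, H.Adj u v → InRange x u v c → 0 ≤ (c - x u) / (x v - x u) ∧
      (c - x u) / (x v - x u) ≤ 1 ∧
      (1 - (c - x u) / (x v - x u)) * x u + (c - x u) / (x v - x u) * x v = c := by
    intro u v huv hc
    have hne := sub_ne_zero.2 (hd.ne huv).symm
    refine ⟨?_, ?_, by field_simp; ring⟩
    · rcases hc with ⟨h1, h2⟩ | ⟨h1, h2⟩
      · exact div_nonneg (by linarith) (by linarith)
      · exact div_nonneg_of_nonpos (by linarith) (by linarith)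
    · rcases hc with ⟨h1, h2⟩ | ⟨h1, h2⟩
      · rw [div_le_one (lt_of_le_of_ne (by linarith) hne.symm)]; linarith
      · rw [div_le_one_of_neg (lt_of_le_of_ne (by linarith) hne)]; linarith
  obtain ⟨a1, a2, a3⟩ := aux u v huv hc
  obtain ⟨b1, b2, b3⟩ := aux z w hzw hc'
  unfold hgt at h
  obtain ⟨e1, e2⟩ := hd.nc u v z w huv hzw h1 h2 h3 _ _ a1 a2 b1 b2 (a3.trans b3.symm)
    (by linarith)
  refine ⟨e1, ?_⟩
  rw [e2] at a3
  linarith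

theorem hgt_lt_of_lt {u v z w : V} {a b : ℝ}
    (hne : ∀ c ∈ Set.uIcc a b, hgt x y u v c ≠ hgt x y z w c)
    (h : hgt x y z w a < hgt x y u v a) : hgt x y z w b < hgt x y u v b := by
  by_contra hb
  push Not at hb
  have hcont : Continuous (fun c => hgt x y u v c - hgt x y z w c) := by
    unfold hgt; fun_prop
  have h0 : (0 : ℝ) ∈ Set.uIcc (hgt x y u v a - hgt x y z w a)
      (hgt x y u v b - hgt x y z w b) := by
    rw [Set.mem_uIcc]; right; constructor <;> linarith
  obtain ⟨c, hc, hc0⟩ := intermediate_value_uIcc hcont.continuousOn h0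
  exact hne c hc (sub_eq_zero.1 hc0)

theorem InRange.of_mem_uIcc {u v : V} {a b c : ℝ} (ha : InRange x u v a) (hb : InRange x u v b)
    (hc : c ∈ Set.uIcc a b) : InRange x u v c := by
  unfold InRange at *
  rw [Set.mem_uIcc] at hc
  rcases hc with hc | hc <;> rcases ha with ha | ha <;> rcases hb with hb | hb
  all_goals first
    | (left; constructor <;> linarith)
    | (right; constructor <;> linarith)

open Classical in
/-- Indicator of `u` lying above the part of the segment `zw` between abscissas `c₀, c₁`. -/
noncomputable def reg (x y : V → ℝ) (z w : V) (c₀ c₁ : ℝ) (u : V) : ZMod 2 :=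
  if c₀ < x u ∧ x u ≤ c₁ ∧ hgt x y z w (x u) < y u then 1 else 0

theorem abv_add_abv {u v z w : V} {t c₀ c₁ : ℝ} (huv : x u ≠ x v)
    (hne : ∀ c, t ≤ c → InRange x u v c → InRange x z w c → hgt x y u v c ≠ hgt x y z w c)
    (ht : t ≤ c₀) (hc : c₀ ≤ c₁) (h₀ : InRange x z w c₀) (h₁ : InRange x z w c₁) :
    abv x y u v c₀ (hgt x y z w c₀) + abv x y u v c₁ (hgt x y z w c₁) =
      reg x y z w c₀ c₁ u + reg x y z w c₀ c₁ v := by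
  wlog hlt : x u < x v generalizing u v
  · rw [abv_symm huv, abv_symm huv, this huv.symm (fun c h1 h2 h3 => by
      rw [← hgt_symm huv]; exact hne c h1 h2.symm h3)
      (lt_of_le_of_ne (not_lt.1 hlt) huv.symm), add_comm]
  have mem : ∀ c, c₀ ≤ c → c ≤ c₁ → InRange x z w c := fun c h1 h2 =>
    h₀.of_mem_uIcc h₁ (by rw [Set.mem_uIcc]; left; exact ⟨h1, h2⟩)
  have key : ∀ a b, c₀ ≤ a → a ≤ c₁ → x u ≤ a → a ≤ x v → c₀ ≤ b → b ≤ c₁ → x u ≤ b → b ≤ x v →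
      hgt x y z w a < hgt x y u v a → hgt x y z w b < hgt x y u v b := by
    intro a b a1 a2 a3 a4 b1 b2 b3 b4
    apply hgt_lt_of_lt
    intro c hc
    rw [Set.mem_uIcc] at hc
    have : (c₀ ≤ c ∧ c ≤ c₁) ∧ x u ≤ c ∧ c ≤ x v := by
      rcases hc with hc | hc <;> refine ⟨⟨?_, ?_⟩, ?_, ?_⟩ <;> linarith
    exact hne c (ht.trans this.1.1) (Or.inl this.2) (mem c this.1.1 this.1.2)
  have hu : hgt x y u v (x u) = y u := hgt_left u v
  have hv : hgt x y u v (x v) = y v := hgt_right huv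
  by_cases hpos : ∃ a, c₀ ≤ a ∧ a ≤ c₁ ∧ x u ≤ a ∧ a ≤ x v ∧ hgt x y z w a < hgt x y u v a
  · obtain ⟨a, a1, a2, a3, a4, ha⟩ := hpos
    have K := fun b => key a b a1 a2 a3 a4
    have e0 : abv x y u v c₀ (hgt x y z w c₀) = if x u ≤ c₀ ∧ c₀ < x v then 1 else 0 := by
      unfold abv
      congr 1
      rw [eq_iff_iff]
      constructor
      · rintro ⟨h | h, -⟩
        · exact h
        · linarith
      · exact fun h => ⟨Or.inl h, K c₀ le_rfl hc (by linarith) (by linarith) ha⟩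
    have e1 : abv x y u v c₁ (hgt x y z w c₁) = if x u ≤ c₁ ∧ c₁ < x v then 1 else 0 := by
      unfold abv
      congr 1
      rw [eq_iff_iff]
      constructor
      · rintro ⟨h | h, -⟩
        · exact h
        · linarith
      · exact fun h => ⟨Or.inl h, K c₁ hc le_rfl (by linarith) (by linarith) ha⟩
    have e2 : reg x y z w c₀ c₁ u = if c₀ < x u ∧ x u ≤ c₁ then 1 else 0 := by
      unfold reg
      congr 1
      rw [eq_iff_iff]
      refine ⟨fun h => ⟨h.1, h.2.1⟩, fun h => ⟨h.1, h.2, ?_⟩⟩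
      have := K (x u) h.1.le h.2 le_rfl hlt.le ha
      rwa [hu] at this
    have e3 : reg x y z w c₀ c₁ v = if c₀ < x v ∧ x v ≤ c₁ then 1 else 0 := by
      unfold reg
      congr 1
      rw [eq_iff_iff]
      refine ⟨fun h => ⟨h.1, h.2.1⟩, fun h => ⟨h.1, h.2, ?_⟩⟩
      have := K (x v) h.1.le h.2 hlt.le le_rfl ha
      rwa [hv] at this
    rw [e0, e1, e2, e3]
    have two : (1 : ZMod 2) + 1 = 0 := by decide
    split_ifs <;> first
      | (exfalso; grind)
      | simp [two]
  · push Not at hpos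
    have e0 : abv x y u v c₀ (hgt x y z w c₀) = 0 := by
      unfold abv
      rw [if_neg]
      rintro ⟨h | h, h'⟩
      · exact absurd h' (not_lt.2 (hpos c₀ le_rfl hc h.1 h.2.le))
      · linarith
    have e1 : abv x y u v c₁ (hgt x y z w c₁) = 0 := by
      unfold abv
      rw [if_neg]
      rintro ⟨h | h, h'⟩
      · exact absurd h' (not_lt.2 (hpos c₁ hc le_rfl h.1 h.2.le))
      · linarith
    have e2 : reg x y z w c₀ c₁ u = 0 := by
      unfold reg
      rw [if_neg]
      rintro ⟨h1, h2, h3⟩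
      have := hpos (x u) h1.le h2 le_rfl hlt.le
      rw [hu] at this
      linarith
    have e3 : reg x y z w c₀ c₁ v = 0 := by
      unfold reg
      rw [if_neg]
      rintro ⟨h1, h2, h3⟩
      have := hpos (x v) h1.le h2 hlt.le le_rfl
      rw [hv] at this
      linarith
    rw [e0, e1, e2, e3]

theorem zmod_two_add_self (a : ZMod 2) : a + a = 0 := by
  revert a; decide

/-- Two connections in the half plane `x > t` leaving through interleaved edges across the
line `x = t` intersect. -/
theorem Drawing.crossing (hd : Drawing H x y) {t : ℝ} {C D : Set V}
    {la lb lc ld a b c d : V} (hC : ∀ v ∈ C, t < x v) (hD : ∀ v ∈ D, t < x v)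
    (hCD : Disjoint C D) (hla : x la < t) (hlb : x lb < t) (hlc : x lc < t) (hld : x ld < t)
    (haa : H.Adj la a) (hbb : H.Adj lb b) (hcc : H.Adj lc c) (hdd : H.Adj ld d)
    (hac : Linked H C a c) (hbd : Linked H D b d)
    (h1 : hgt x y la a t < hgt x y lb b t) (h2 : hgt x y lb b t < hgt x y lc c t)
    (h3 : hgt x y lc c t < hgt x y ld d t) : False := by
  obtain ⟨p, hp⟩ := hac
  obtain ⟨q, hq⟩ := hbd
  let F : ℝ → ℝ → ZMod 2 := fun c₀ h => abv x y la a c₀ h + par x y c₀ h p + abv x y lc c c₀ h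
  have hne : ∀ u v z w, H.Adj u v → H.Adj z w → v ∈ C → w ∈ D → (u ∈ C ∨ x u < t) →
      (z ∈ D ∨ x z < t) → ∀ c, t ≤ c → InRange x u v c → InRange x z w c →
      hgt x y u v c ≠ hgt x y z w c := by
    intro u v z w huv hzw hv hw hu hz c' hc' r1 r2 heq
    have dis := Set.disjoint_left.1 hCD
    obtain ⟨e1, e2⟩ := hd.hgt_ne huv hzw (fun h => dis hv (h ▸ hw))
      (fun h => by
        subst h
        rcases hu with h | h
        · exact dis h hw
        · exact absurd h (not_lt.2 (hD _ hw).le))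
      (fun h => by
        subst h
        rcases hz with h | h
        · exact dis hv h
        · exact absurd h (not_lt.2 (hC _ hv).le)) r1 r2 heq
    subst e1
    have hut : x u < t := by
      rcases hu with h | h
      · rcases hz with h' | h'
        · exact absurd h' (dis h)
        · exact h'
      · exact h
    linarith
  have tel : ∀ z w c₀ c₁, H.Adj z w → w ∈ D → (z ∈ D ∨ x z < t) → t ≤ c₀ → c₀ ≤ c₁ →
      InRange x z w c₀ → InRange x z w c₁ →
      F c₀ (hgt x y z w c₀) = F c₁ (hgt x y z w c₁) := by
    intro z w c₀ c₁ hzw hw hz ht hc r0 r1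
    have hedge : ∀ u v, H.Adj u v → v ∈ C → (u ∈ C ∨ x u < t) →
        abv x y u v c₀ (hgt x y z w c₀) + abv x y u v c₁ (hgt x y z w c₁) =
          reg x y z w c₀ c₁ u + reg x y z w c₀ c₁ v := fun u v huv hv hu =>
      abv_add_abv (hd.ne huv) (hne u v z w huv hzw hv hw hu hz) ht hc r0 r1
    have hpar : ∀ {u v} (p : H.Walk u v), (∀ x ∈ p.support, x ∈ C) →
        par x y c₀ (hgt x y z w c₀) p + par x y c₁ (hgt x y z w c₁) p =
          reg x y z w c₀ c₁ u + reg x y z w c₀ c₁ v := by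
      intro u v p
      induction p with
      | nil => intro _; simp [par, zmod_two_add_self]
      | @cons u v k huv p ih =>
        intro hp
        have i1 := ih (fun x hx => hp x (by simp [hx]))
        have i2 := hedge u v huv (hp v (by simp)) (Or.inl (hp u (by simp)))
        have i3 := zmod_two_add_self (reg x y z w c₀ c₁ v)
        simp only [par]
        linear_combination i1 + i2 + i3
    have hl : ∀ l, x l < t → reg x y z w c₀ c₁ l = 0 := by
      intro l hl
      unfold reg
      rw [if_neg]
      rintro ⟨h, -⟩
      linarith
    have j1 := hedge la a haa (hp a p.start_mem_support) (Or.inr hla)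
    have j2 := hedge lc c hcc (hp c p.end_mem_support) (Or.inr hlc)
    have j3 := hpar p hp
    rw [hl la hla] at j1
    rw [hl lc hlc] at j2
    have k1 := zmod_two_add_self (reg x y z w c₀ c₁ a)
    have k2 := zmod_two_add_self (reg x y z w c₀ c₁ c)
    have k3 := zmod_two_add_self (F c₁ (hgt x y z w c₁))
    have : F c₀ (hgt x y z w c₀) + F c₁ (hgt x y z w c₁) = 0 := by
      simp only [F]
      linear_combination j1 + j2 + j3 + k1 + k2
    linear_combination this - k3
  have along : ∀ {u v} (q : H.Walk u v), (∀ x ∈ q.support, x ∈ D) →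
      F (x u) (y u) = F (x v) (y v) := by
    intro u v q
    induction q with
    | nil => intro _; rfl
    | @cons u v k huv q ih =>
      intro hq
      rw [← ih (fun x hx => hq x (by simp [hx]))]
      have hu := hq u (by simp)
      have hv := hq v (by simp)
      have hne := hd.ne huv
      rcases le_total (x u) (x v) with h | h
      · have := tel u v (x u) (x v) huv hv (Or.inl hu) (hD u hu).le h (Or.inl ⟨le_rfl, h⟩)
          (Or.inl ⟨h, le_rfl⟩)
        rwa [hgt_left, hgt_right hne] at this
      · have := tel v u (x v) (x u) huv.symm hu (Or.inl hv) (hD v hv).le h (Or.inl ⟨le_rfl, h⟩)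
          (Or.inl ⟨h, le_rfl⟩)
        rw [hgt_left, hgt_right hne.symm] at this
        exact this.symm
  have hb := hD b (hq b q.start_mem_support)
  have hdm := hD d (hq d q.end_mem_support)
  have st : F t (hgt x y lb b t) = F t (hgt x y ld d t) := by
    have s1 := tel lb b t (x b) hbb (hq b q.start_mem_support) (Or.inr hlb) le_rfl hb.le
      (Or.inl ⟨hlb.le, hb.le⟩) (Or.inl ⟨by linarith, le_rfl⟩)
    have s2 := tel ld d t (x d) hdd (hq d q.end_mem_support) (Or.inr hld) le_rfl hdm.le
      (Or.inl ⟨hld.le, hdm.le⟩) (Or.inl ⟨by linarith, le_rfl⟩)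
    rw [hgt_right (hd.ne hbb)] at s1
    rw [hgt_right (hd.ne hdd)] at s2
    rw [s1, s2]
    exact along q hq
  have par0 : ∀ h {u v} (p : H.Walk u v), (∀ x ∈ p.support, x ∈ C) → par x y t h p = 0 := by
    intro h u v p
    induction p with
    | nil => intro _; rfl
    | @cons u v k huv p ih =>
      intro hp
      have hu := hC u (hp u (by simp))
      have hv := hC v (hp v (by simp))
      simp only [par]
      rw [ih (fun x hx => hp x (by simp [hx])), add_zero, abv, if_neg]
      rintro ⟨⟨h, -⟩ | ⟨h, -⟩, -⟩ <;> linarith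
  have ha := hC a (hp a p.start_mem_support)
  have hc := hC c (hp c p.end_mem_support)
  simp only [F, par0 _ p hp, abv] at st
  rw [if_neg (by rintro ⟨-, h⟩; linarith), if_pos ⟨Or.inl ⟨hlc.le, hc⟩, h2⟩,
    if_neg (by rintro ⟨-, h⟩; linarith), if_neg (by rintro ⟨-, h⟩; linarith)] at st
  revert st
  decide

end
section
variable {V : Type}

/-- The power of the point `w` with respect to a circle. -/
def disc (x y : V → ℝ) (α β γ : ℝ) (w : V) : ℝ :=
  x w ^ 2 + y w ^ 2 + α * x w + β * y w + γ

/-- The edges of `G` both of whose ends, and no other vertices, lie in some disc. -/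
def delaunay (G : SimpleGraph V) (x y : V → ℝ) : SimpleGraph V where
  Adj u v := G.Adj u v ∧ ∃ α β γ, disc x y α β γ u ≤ 0 ∧ disc x y α β γ v ≤ 0 ∧
    ∀ w, w ≠ u → w ≠ v → 0 < disc x y α β γ w
  symm := ⟨fun _ _ ⟨h, α, β, γ, h1, h2, h3⟩ => ⟨h.symm, α, β, γ, h2, h1, fun w a b => h3 w b a⟩⟩
  loopless := ⟨fun _ h => h.1.ne rfl⟩

theorem delaunay_le (G : SimpleGraph V) (x y : V → ℝ) : delaunay G x y ≤ G := fun _ _ h => h.1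

theorem convex_comb_neg {a b s : ℝ} (ha : a < 0) (hb : b < 0) (h0 : 0 ≤ s) (h1 : s ≤ 1) :
    (1 - s) * a + s * b < 0 := by
  rcases h0.eq_or_lt with rfl | h
  · simpa using ha
  · have := mul_neg_of_pos_of_neg h hb
    have := mul_nonpos_of_nonneg_of_nonpos (sub_nonneg.2 h1) ha.le
    linarith

theorem disc_segment {x y : V → ℝ} {α β γ : ℝ} {u v w : V} {s : ℝ} (h0 : 0 ≤ s) (h1 : s ≤ 1)
    (hx : x v - x u = s * (x w - x u)) (hy : y v - y u = s * (y w - y u))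
    (hu : disc x y α β γ u ≤ 0) (hw : disc x y α β γ w ≤ 0) : disc x y α β γ v ≤ 0 := by
  have e : disc x y α β γ v = (1 - s) * disc x y α β γ u + s * disc x y α β γ w -
      s * (1 - s) * ((x u - x w) ^ 2 + (y u - y w) ^ 2) := by
    have hx' : x v = x u + s * (x w - x u) := by linarith
    have hy' : y v = y u + s * (y w - y u) := by linarith
    unfold disc
    rw [hx', hy']
    ring
  have a1 := mul_nonpos_of_nonneg_of_nonpos (sub_nonneg.2 h1) hu
  have a2 := mul_nonpos_of_nonneg_of_nonpos h0 hw
  have a3 : 0 ≤ s * (1 - s) * ((x u - x w) ^ 2 + (y u - y w) ^ 2) :=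
    mul_nonneg (mul_nonneg h0 (sub_nonneg.2 h1)) (by positivity)
  linarith

theorem delaunay_drawing (G : SimpleGraph V) {x y : V → ℝ} (hx : Function.Injective x) :
    Drawing (delaunay G x y) x y := by
  refine ⟨hx, ?_⟩
  rintro u v z w ⟨huv, α, β, γ, g1, g2, g3⟩ ⟨hzw, α', β', γ', k1, k2, k3⟩ hvw huw hvz s s'
    h0 h1 h0' h1' ex ey
  by_cases huz : u = z
  · refine ⟨huz, ?_⟩
    subst huz
    by_contra hs
    have hs : 0 < s := lt_of_le_of_ne h0 (Ne.symm hs)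
    have ex' : s * (x v - x u) = s' * (x w - x u) := by linarith
    have ey' : s * (y v - y u) = s' * (y w - y u) := by linarith
    have hs' : 0 < s' := by
      refine lt_of_le_of_ne h0' (fun h => ?_)
      rw [← h, zero_mul] at ex'
      rcases mul_eq_zero.1 ex' with h | h
      · exact hs.ne' h
      · exact huv.ne' (hx (sub_eq_zero.1 h))
    rcases le_total s' s with h | h
    · have := disc_segment (s := s' / s) (v := v) (u := u) (w := w) (by positivity)
        ((div_le_one hs).2 h) (by field_simp; linarith) (by field_simp; linarith) k1 k2
      exact absurd this (not_le.2 (k3 v huv.ne' hvw))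
    · have := disc_segment (s := s / s') (v := w) (u := u) (w := v) (by positivity)
        ((div_le_one hs').2 h) (by field_simp; linarith) (by field_simp; linarith) g1 g2
      exact absurd this (not_le.2 (g3 w hzw.ne' hvw.symm))
  · exfalso
    have a1 := g3 z (Ne.symm huz) hvz.symm
    have a2 := g3 w huw.symm hvw.symm
    have b1 := k3 u huz huw
    have b2 := k3 v hvz hvw
    have c1 := convex_comb_neg (a := disc x y α β γ u - disc x y α' β' γ' u)
      (b := disc x y α β γ v - disc x y α' β' γ' v) (by linarith) (by linarith) h0 h1
    have c2 := convex_comb_neg (a := disc x y α' β' γ' z - disc x y α β γ z)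
      (b := disc x y α' β' γ' w - disc x y α β γ w) (by linarith) (by linarith) h0' h1'
    unfold disc at c1 c2
    have : (1 - s) * ((α - α') * x u + (β - β') * y u + (γ - γ')) +
        s * ((α - α') * x v + (β - β') * y v + (γ - γ')) =
        (1 - s') * ((α - α') * x z + (β - β') * y z + (γ - γ')) +
        s' * ((α - α') * x w + (β - β') * y w + (γ - γ')) := by
      linear_combination (α - α') * ex + (β - β') * ey
    linarith

open Filter Topology in
theorem eventually_add_mul_pos {a : ℝ} (b : ℝ) (h : 0 < a) : ∀ᶠ e in 𝓝[>] (0 : ℝ), 0 < a + e * b := by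
  have : Tendsto (fun e : ℝ => a + e * b) (𝓝[>] 0) (𝓝 (a + 0 * b)) :=
    Tendsto.mono_left (Continuous.tendsto (by fun_prop) 0) nhdsWithin_le_nhds
  exact this.eventually (lt_mem_nhds (by simpa using h))

open Filter Topology in
theorem eventually_add_mul_ne {a b : ℝ} (h : a ≠ 0 ∨ b ≠ 0) :
    ∀ᶠ e in 𝓝[>] (0 : ℝ), a + e * b ≠ 0 := by
  by_cases ha : a = 0
  · subst ha
    filter_upwards [self_mem_nhdsWithin] with e (he : 0 < e)
    simpa using ⟨he.ne', h.resolve_left (by simp)⟩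
  · rcases lt_or_gt_of_ne ha with h | h
    · filter_upwards [eventually_add_mul_pos (-b) (neg_pos.2 h)] with e he
      linarith
    · filter_upwards [eventually_add_mul_pos b h] with e he
      exact he.ne'

open Filter Topology in
theorem exists_generic_disc [Finite V] {x : V → ℝ} (y : V → ℝ) (hx : Function.Injective x)
    (α β γ : ℝ) : ∃ α' γ', (∀ w, disc x y α β γ w ≤ 0 ↔ disc x y α' β γ' w ≤ 0) ∧
      Function.Injective (disc x y α' β γ') := by
  have h1 : ∀ᶠ δ in 𝓝[>] (0 : ℝ), ∀ w, 0 < disc x y α β γ w → 0 < disc x y α β γ w + δ * (-1) :=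
    eventually_all.2 fun w => by
      by_cases h : 0 < disc x y α β γ w
      · filter_upwards [eventually_add_mul_pos (-1) h] with δ hδ _ using hδ
      · exact Eventually.of_forall fun _ h' => absurd h' h
  obtain ⟨δ, hδ, hδ0 : 0 < δ⟩ := (h1.and self_mem_nhdsWithin).exists
  have h2 : ∀ᶠ e in 𝓝[>] (0 : ℝ), ∀ w, 0 < disc x y α β γ w + δ * (-1) →
      0 < disc x y α β γ w + δ * (-1) + e * x w :=
    eventually_all.2 fun w => by
      by_cases h : 0 < disc x y α β γ w + δ * (-1)
      · filter_upwards [eventually_add_mul_pos (x w) h] with δ hδ _ using hδ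
      · exact Eventually.of_forall fun _ h' => absurd h' h
  have h3 : ∀ᶠ e in 𝓝[>] (0 : ℝ), ∀ w, 0 < -(disc x y α β γ w + δ * (-1)) →
      0 < -(disc x y α β γ w + δ * (-1)) + e * (-x w) :=
    eventually_all.2 fun w => by
      by_cases h : 0 < -(disc x y α β γ w + δ * (-1))
      · filter_upwards [eventually_add_mul_pos (-x w) h] with δ hδ _ using hδ
      · exact Eventually.of_forall fun _ h' => absurd h' h
  have h4 : ∀ᶠ e in 𝓝[>] (0 : ℝ), ∀ u v, u ≠ v →
      disc x y α β γ u - disc x y α β γ v + e * (x u - x v) ≠ 0 :=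
    eventually_all.2 fun u => eventually_all.2 fun v => by
      by_cases h : u = v
      · exact Eventually.of_forall fun _ h' => absurd h h'
      · filter_upwards [eventually_add_mul_ne
          (Or.inr (sub_ne_zero.2 (fun h' => h (hx h'))))] with δ hδ _ using hδ
  obtain ⟨e, ⟨e2, e3⟩, e4⟩ := ((h2.and h3).and h4).exists
  have key : ∀ w, disc x y (α + e) β (γ - δ) w = disc x y α β γ w + δ * (-1) + e * x w := by
    intro w; unfold disc; ring
  refine ⟨α + e, γ - δ, fun w => ?_, fun u v huv => ?_⟩
  · rw [key]
    constructor
    · intro h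
      have := e3 w (by linarith)
      linarith
    · intro h
      by_contra h'
      have := e2 w (hδ w (not_le.1 h'))
      linarith
  · rw [key, key] at huv
    by_contra hne
    exact e4 u v hne (by linarith)

open Filter Topology in
/-- The vertices in a disc containing pairwise adjacent vertices are connected in the
Delaunay subgraph. -/
theorem delaunay_linked [Finite V] (G : SimpleGraph V) {x y : V → ℝ} (hx : Function.Injective x)
    (α β γ : ℝ) (hcl : ∀ u v, disc x y α β γ u ≤ 0 → disc x y α β γ v ≤ 0 → u ≠ v → G.Adj u v)
    (u v : V) (hu : disc x y α β γ u ≤ 0) (hv : disc x y α β γ v ≤ 0) :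
    Linked (delaunay G x y) {w | disc x y α β γ w ≤ 0} u v := by
  induction hn : {w | disc x y α β γ w ≤ 0}.ncard using Nat.strong_induction_on
    generalizing α β γ u v with
  | _ n ih =>
  obtain ⟨α', γ', hF, hinj⟩ := exists_generic_disc y hx α β γ
  simp only [hF] at hcl hu hv hn ⊢
  clear hF α γ
  rename' α' => α, γ' => γ
  set g := disc x y α β γ with hg
  obtain ⟨m, hm, hmax⟩ := Set.exists_max_image {w | g w ≤ 0} g (Set.toFinite _) ⟨u, hu⟩
  have hlt : ∀ w, g w ≤ 0 → w ≠ m → g w < g m := fun w h1 h2 =>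
    lt_of_le_of_ne (hmax w h1) (fun h => h2 (hinj h))
  -- squared distance to `m`
  let d : V → ℝ := fun w => (x w - x m) ^ 2 + (y w - y m) ^ 2
  have hd : ∀ w, w ≠ m → 0 < d w := fun w hw => by
    have := sub_ne_zero.2 (fun h => hw (hx h))
    simp only [d]; positivity
  have E1 : ∀ᶠ δ in 𝓝[>] (0 : ℝ), ∀ w, 0 < g w - g m → 0 < g w - g m + δ * (-1) :=
    eventually_all.2 fun w => by
      by_cases h : 0 < g w - g m
      · filter_upwards [eventually_add_mul_pos (-1) h] with δ hδ _ using hδ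
      · exact Eventually.of_forall fun _ h' => absurd h' h
  have E2 : ∀ᶠ δ in 𝓝[>] (0 : ℝ), ∀ w, 0 < g m - g w → 0 < g m - g w + δ * (-1) :=
    eventually_all.2 fun w => by
      by_cases h : 0 < g m - g w
      · filter_upwards [eventually_add_mul_pos (-1) h] with δ hδ _ using hδ
      · exact Eventually.of_forall fun _ h' => absurd h' h
  have E3 : ∀ᶠ δ in 𝓝[>] (0 : ℝ), ∀ w w', w ≠ w' → w ≠ m →
      ((g m - g w) * d w' - (g m - g w') * d w) + δ * (d w' - d w) ≠ 0 :=
    eventually_all.2 fun w => eventually_all.2 fun w' => by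
      by_cases h : w ≠ w' ∧ w ≠ m
      · have : ((g m - g w) * d w' - (g m - g w') * d w) ≠ 0 ∨ d w' - d w ≠ 0 := by
          by_contra! hh
          obtain ⟨h1, h2⟩ := hh
          rw [sub_eq_zero.1 h2] at h1
          have : (g w' - g w) * d w = 0 := by linarith
          rcases mul_eq_zero.1 this with h3 | h3
          · exact h.1 (hinj (sub_eq_zero.1 h3)).symm
          · exact (hd w h.2).ne' h3
        filter_upwards [eventually_add_mul_ne this] with δ hδ _ _ using hδ
      · exact Eventually.of_forall fun _ h' h'' => absurd ⟨h', h''⟩ h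
  obtain ⟨δ, ⟨⟨e1, e2⟩, e3⟩, hδ : 0 < δ⟩ := (((E1.and E2).and E3).and self_mem_nhdsWithin).exists
  have gpos : ∀ w, ¬ g w ≤ 0 → 0 < g w - g m - δ := fun w hw => by
    have := e1 w (by linarith [show g m ≤ 0 from hm, not_le.1 hw])
    linarith
  -- the smaller disc
  have hsub : ∀ w, disc x y α β (γ - g m + δ) w = g w - g m + δ := fun w => by
    simp only [hg, disc]; ring
  have hsub' : ∀ w, disc x y α β (γ - g m + δ) w ≤ 0 ↔ g w ≤ 0 ∧ w ≠ m := fun w => by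
    rw [hsub]
    constructor
    · intro h
      refine ⟨by linarith [show g m ≤ 0 from hm], ?_⟩
      rintro rfl
      linarith
    · rintro ⟨h1, h2⟩
      have := e2 w (by linarith [hlt w h1 h2])
      linarith
  have hIH : ∀ u v, g u ≤ 0 → u ≠ m → g v ≤ 0 → v ≠ m →
      Linked (delaunay G x y) {w | g w ≤ 0} u v := by
    intro u v hu hum hv hvm
    refine (ih _ ?_ α β (γ - g m + δ) (fun a b ha hb => ?_) u v ((hsub' u).2 ⟨hu, hum⟩)
      ((hsub' v).2 ⟨hv, hvm⟩) rfl).mono (fun w hw => ((hsub' w).1 hw).1)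
    · rw [← hn]
      apply Set.ncard_lt_ncard _ (Set.toFinite _)
      refine ⟨fun w hw => ((hsub' w).1 hw).1, fun h => ?_⟩
      exact ((hsub' m).1 (h hm)).2 rfl
    · exact hcl a b ((hsub' a).1 ha).1 ((hsub' b).1 hb).1
  have hm_link : ∀ u, g u ≤ 0 → Linked (delaunay G x y) {w | g w ≤ 0} u m := by
    intro u hu
    by_cases hum : u = m
    · subst hum; exact Linked.refl hu
    let s : V → ℝ := fun w => (g m + δ - g w) / d w
    obtain ⟨a, ⟨ha, ham⟩, hamax⟩ := Set.exists_max_image {w | g w ≤ 0 ∧ w ≠ m} s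
      (Set.toFinite _) ⟨u, hu, hum⟩
    refine (hIH u a hu hum ha ham).trans (Linked.of_adj ⟨hcl a m ha hm ham, ?_⟩ ha hm)
    have hsa : 0 < s a := div_pos (by linarith [hlt a ha ham]) (hd a ham)
    have hsd : s a * d a = g m + δ - g a := div_mul_cancel₀ _ (hd a ham).ne'
    have hs1 : (1 : ℝ) + s a ≠ 0 := by positivity
    have hform : ∀ w, disc x y ((α - 2 * s a * x m) / (1 + s a))
        ((β - 2 * s a * y m) / (1 + s a))
        ((γ - g m - δ + s a * (x m ^ 2 + y m ^ 2)) / (1 + s a)) w =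
        (g w - (g m + δ) + s a * d w) / (1 + s a) := fun w => by
      rw [eq_div_iff hs1]
      simp only [hg, disc, d]
      field_simp
      ring
    refine ⟨_, _, _, (hform a).trans_le ?_, (hform m).trans_le ?_, fun w hwa hwm => ?_⟩
    · rw [hsd]
      simp
    · have : d m = 0 := by simp [d]
      rw [this]
      exact div_nonpos_of_nonpos_of_nonneg (by linarith) (by positivity)
    · rw [hform]
      refine div_pos ?_ (by positivity)
      have hdw := hd w hwm
      by_cases hw : g w ≤ 0
      · have h1 := hamax w ⟨hw, hwm⟩
        have hsw : s w * d w = g m + δ - g w := div_mul_cancel₀ _ hdw.ne'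
        have hne : s w ≠ s a := by
          intro h
          apply e3 w a hwa hwm
          have h' : (g m + δ - g w) * d a = (g m + δ - g a) * d w := by
            rw [← hsd, ← hsw, h]; ring
          linarith
        have := mul_lt_mul_of_pos_right (lt_of_le_of_ne h1 hne) hdw
        linarith
      · have := gpos w hw
        have := mul_pos hsa hdw
        linarith
  exact (hm_link u hu).trans (hm_link v hv).symm

open Filter Topology in
/-- A finite unit disk graph can be realized by points with distinct abscissas, with an
arbitrary squared distance threshold. -/
theorem exists_generic_realization [Finite V] {G : SimpleGraph V} (hG : IsUnitDiskGraph G) :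
    ∃ (x y : V → ℝ) (ρ : ℝ), Function.Injective x ∧
      ∀ u v, G.Adj u v ↔ u ≠ v ∧ (x u - x v) ^ 2 + (y u - y v) ^ 2 ≤ ρ := by
  obtain ⟨c, hc⟩ := hG
  let X : V → ℝ := fun v => c v 0
  let Y : V → ℝ := fun v => c v 1
  have hdist : ∀ u v, dist (c u) (c v) ≤ 2 ↔ (X u - X v) ^ 2 + (Y u - Y v) ^ 2 ≤ 4 := by
    intro u v
    rw [EuclideanSpace.dist_eq, Real.sqrt_le_left (by norm_num)]
    simp only [Fin.sum_univ_two, Real.dist_eq, sq_abs, X, Y]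
    norm_num
  let e : V → ℝ := fun v => ((Finite.equivFin V v : ℕ) : ℝ)
  have he : Function.Injective e := fun u v h =>
    (Finite.equivFin V).injective (Fin.ext (Nat.cast_injective h))
  let q : V → V → ℝ := fun u v => (X u - X v) ^ 2 + (Y u - Y v) ^ 2
  have h1 : ∀ᶠ δ in 𝓝[>] (0 : ℝ), ∀ u v, 0 < q u v - 4 → 0 < q u v - 4 + δ * (-1) :=
    eventually_all.2 fun u => eventually_all.2 fun v => by
      by_cases h : 0 < q u v - 4
      · filter_upwards [eventually_add_mul_pos (-1) h] with δ hδ _ using hδ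
      · exact Eventually.of_forall fun _ h' => absurd h' h
  obtain ⟨δ, hδ, hδ0 : 0 < δ⟩ := (h1.and self_mem_nhdsWithin).exists
  let Q : V → V → ℝ → ℝ := fun u v ε =>
    (X u + ε * e u - (X v + ε * e v)) ^ 2 + (Y u - Y v) ^ 2
  have hQ0 : ∀ u v, Q u v 0 = q u v := fun u v => by simp [Q, q]
  have hQt : ∀ u v, Tendsto (Q u v) (𝓝[>] 0) (𝓝 (q u v)) := fun u v => by
    rw [← hQ0]
    exact Tendsto.mono_left (Continuous.tendsto (by simp only [Q]; fun_prop) 0) nhdsWithin_le_nhds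
  have h2 : ∀ᶠ ε in 𝓝[>] (0 : ℝ), ∀ u v, q u v < 4 + δ → Q u v ε < 4 + δ :=
    eventually_all.2 fun u => eventually_all.2 fun v => by
      by_cases h : q u v < 4 + δ
      · filter_upwards [(hQt u v).eventually (gt_mem_nhds h)] with ε hε _ using hε
      · exact Eventually.of_forall fun _ h' => absurd h' h
  have h3 : ∀ᶠ ε in 𝓝[>] (0 : ℝ), ∀ u v, 4 + δ < q u v → 4 + δ < Q u v ε :=
    eventually_all.2 fun u => eventually_all.2 fun v => by
      by_cases h : 4 + δ < q u v
      · filter_upwards [(hQt u v).eventually (lt_mem_nhds h)] with ε hε _ using hε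
      · exact Eventually.of_forall fun _ h' => absurd h' h
  have h4 : ∀ᶠ ε in 𝓝[>] (0 : ℝ), ∀ u v, u ≠ v → X u - X v + ε * (e u - e v) ≠ 0 :=
    eventually_all.2 fun u => eventually_all.2 fun v => by
      by_cases h : u = v
      · exact Eventually.of_forall fun _ h' => absurd h h'
      · filter_upwards [eventually_add_mul_ne
          (Or.inr (sub_ne_zero.2 (fun h' => h (he h'))))] with δ hδ _ using hδ
  obtain ⟨ε, ⟨e2, e3⟩, e4⟩ := ((h2.and h3).and h4).exists
  refine ⟨fun v => X v + ε * e v, Y, 4 + δ, fun u v huv => ?_, fun u v => ?_⟩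
  · by_contra hne
    exact e4 u v hne (by simp only at huv; linarith)
  · rw [hc, hdist]
    refine and_congr_right fun _ => ⟨fun h => (e2 u v (lt_of_le_of_lt h (by linarith))).le,
      fun h => ?_⟩
    by_contra h'
    have := hδ u v (by simp only [q]; linarith [not_le.1 h'])
    exact absurd h (not_le.2 (e3 u v (by linarith)))

theorem exists_planar_subgraph [Finite V] {G : SimpleGraph V} (hG : IsUnitDiskGraph G) :
    ∃ (H : SimpleGraph V) (x y : V → ℝ), H ≤ G ∧ Drawing H x y ∧
      ∀ v u, G.Adj v u → Linked H (insert v (G.neighborSet v)) v u := by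
  obtain ⟨x, y, ρ, hx, hadj⟩ := exists_generic_realization hG
  refine ⟨delaunay G x y, x, y, delaunay_le G x y, delaunay_drawing G hx, fun v u huv => ?_⟩
  have hρ := ((hadj v u).1 huv).2
  have hdisc : ∀ w, disc x y (-(x u + x v)) (-(y u + y v)) (x u * x v + y u * y v) w =
      (x w - x u) * (x w - x v) + (y w - y u) * (y w - y v) := fun w => by unfold disc; ring
  have hcl : ∀ a b, disc x y (-(x u + x v)) (-(y u + y v)) (x u * x v + y u * y v) a ≤ 0 →
      disc x y (-(x u + x v)) (-(y u + y v)) (x u * x v + y u * y v) b ≤ 0 → a ≠ b →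
      G.Adj a b := by
    intro a b ha hb hab
    rw [hdisc] at ha hb
    rw [hadj]
    refine ⟨hab, le_trans ?_ hρ⟩
    nlinarith [sq_nonneg (x a + x b - x u - x v), sq_nonneg (y a + y b - y u - y v)]
  have hv : disc x y (-(x u + x v)) (-(y u + y v)) (x u * x v + y u * y v) v ≤ 0 := by
    rw [hdisc]; simp
  have hu : disc x y (-(x u + x v)) (-(y u + y v)) (x u * x v + y u * y v) u ≤ 0 := by
    rw [hdisc]; simp
  refine (delaunay_linked G hx _ _ _ hcl v u hv hu).mono fun w hw => ?_
  by_cases h : w = v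
  · exact Or.inl h
  · exact Or.inr (hcl v w hv hw (Ne.symm h))

end
section
variable {V : Type} {H : SimpleGraph V}

/-- The edges of `H` with both ends in `S`, on the same vertex set. -/
def restrict (H : SimpleGraph V) (S : Set V) : SimpleGraph V where
  Adj u v := H.Adj u v ∧ u ∈ S ∧ v ∈ S
  symm := ⟨fun _ _ ⟨h, h1, h2⟩ => ⟨h.symm, h2, h1⟩⟩
  loopless := ⟨fun _ h => h.1.ne rfl⟩

theorem restrict_le (H : SimpleGraph V) (S : Set V) : restrict H S ≤ H := fun _ _ h => h.1

theorem Linked.of_restrict {S C : Set V} {u v : V} (h : Linked (restrict H S) C u v)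
    (hu : u ∈ S) : Linked H (C ∩ S) u v := by
  obtain ⟨p, hp⟩ := h
  induction p with
  | nil => exact Linked.refl ⟨hp _ (by simp), hu⟩
  | cons h p ih =>
    have := ih h.2.2 (fun x hx => hp x (by simp [hx]))
    exact Linked.trans (Linked.of_adj h.1 ⟨hp _ (by simp), hu⟩ this.left_mem) this

/-- Connections between interleaved pairs of terminals intersect. -/
def CrossFree {ι : Type} [LinearOrder ι] (H : SimpleGraph V) (τ : ι → V) : Prop :=
  ∀ a b c d, a < b → b < c → c < d → ∀ C D, Linked H C (τ a) (τ c) → Linked H D (τ b) (τ d) →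
    ¬ Disjoint C D

/-- A set which meets every member of a family of disjoint sets in the terminal of that family,
when the set has as many elements as the family has members. -/
theorem exists_terminal_eq [Finite V] {q : ℕ} {P : Fin q → Set V} {f : Fin q → V} {X : Set V}
    (hP : ∀ i j, i ≠ j → Disjoint (P i) (P j)) (hf : ∀ i, f i ∈ P i) (hfX : ∀ i, f i ∈ X)
    (hX : X.ncard = q) : Set.range f = X := by
  have hinj : Function.Injective f := fun i j hij => by
    by_contra hne
    exact Set.disjoint_left.1 (hP i j hne) (hf i) (hij ▸ hf j)
  apply Set.eq_of_subset_of_ncard_le (by rintro _ ⟨i, rfl⟩; exact hfX i) _ (Set.toFinite _)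
  rw [hX, ← Set.image_univ, Set.ncard_image_of_injective _ hinj, Set.ncard_univ,
    Nat.card_eq_fintype_card, Fintype.card_fin]

set_option maxHeartbeats 1000000 in
/-- A set of vertices not split by any small separation yields a cross-free society with
well-linked terminals. -/
theorem exists_society [Finite V] {x y : V → ℝ} (hd : Drawing H x y) {Δ r : ℕ}
    (hΔ : ∀ v : V, (H.neighborSet v).ncard ≤ Δ) (hr : 1 ≤ r) (W : Set V)
    (hW : W.ncard = 17 * r + 4 * Δ)
    (hsep : ∀ A B, IsSep H A B → (A ∩ B).ncard ≤ 4 * r + Δ →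
      (W \ A).ncard < 4 * r + Δ ∨ (W \ B).ncard < 4 * r + Δ) :
    ∃ (H' : SimpleGraph V) (q : ℕ) (τ : Fin q → V), H' ≤ H ∧ 4 * r ≤ q ∧ CrossFree H' τ ∧
      ∀ I J : Set (Fin q), r ≤ I.ncard → r ≤ J.ncard → HasLinkage H' (τ '' I) (τ '' J) r := by
  classical
  let Good : ℝ → Set V → Set V → Prop := fun s A B =>
    IsSep H A B ∧ {v | x v < s} ⊆ A ∧ Disjoint {v | x v < s} B ∧ (W \ B).ncard < 4 * r + Δ
  let P : ℕ → Prop := fun n => ∃ s, {v | x v < s}.ncard = n ∧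
    ∀ A B, Good s A B → 4 * r ≤ (A ∩ B).ncard
  have hne : W.Nonempty := by
    rw [← Set.ncard_pos (Set.toFinite _)]; omega
  have : Nonempty V := ⟨hne.some⟩
  have hP : ∃ n, P n := by
    obtain ⟨m, hm⟩ := Finite.exists_max x
    refine ⟨_, x m + 1, rfl, fun A B hAB => ?_⟩
    exfalso
    obtain ⟨-, -, h1, h2⟩ := hAB
    have : B = ∅ := by
      ext v
      simp only [mem_empty_iff_false, iff_false]
      exact Set.disjoint_left.1 h1 (show x v < x m + 1 by linarith [hm v])
    rw [this, Set.sdiff_empty] at h2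
    omega
  obtain ⟨s, hs1, hs2⟩ := Nat.find_spec hP
  have hmin := fun m => Nat.find_min hP (m := m)
  rw [← hs1] at hmin
  set L := {v | x v < s} with hL
  have hLne : L.Nonempty := by
    by_contra h
    rw [Set.not_nonempty_iff_eq_empty] at h
    have := hs2 ∅ Set.univ ⟨⟨fun v => Or.inr trivial, fun u v _ => Or.inr ⟨trivial, trivial⟩⟩,
      by rw [← hL, h], by rw [← hL, h]; simp, by simp; omega⟩
    simp at this
    omega
  obtain ⟨v, hvL, hvmax⟩ := Set.exists_max_image L x (Set.toFinite _) hLne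
  -- a good separation of small order
  obtain ⟨A₁, B₁, hg₁, ho₁⟩ : ∃ A B, Good s A B ∧ (A ∩ B).ncard + 1 ≤ 4 * r + Δ := by
    have hlt : {u | x u < x v}.ncard < L.ncard := by
      apply Set.ncard_lt_ncard _ (Set.toFinite _)
      refine ⟨fun u (hu : x u < x v) => show x u < s from lt_trans hu hvL, fun h => ?_⟩
      exact lt_irrefl (x v) (h hvL)
    have := hmin _ hlt
    have hnot : ¬ ∀ A B, Good (x v) A B → 4 * r ≤ (A ∩ B).ncard := fun h => this ⟨x v, rfl, h⟩
    push Not at hnot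
    obtain ⟨A₀, B₀, ⟨g1, g2, g3, g4⟩, g5⟩ := hnot
    have hLv : ∀ u ∈ L, u = v ∨ x u < x v := fun u hu => by
      rcases (hvmax u hu).eq_or_lt with h | h
      · exact Or.inl (hd.inj h)
      · exact Or.inr h
    have hvN := hΔ v
    have hsep' : IsSep H (A₀ ∪ insert v (H.neighborSet v)) (B₀ \ {v}) := by
      refine ⟨fun u => ?_, fun a b hab => ?_⟩
      · rcases g1.1 u with h | h
        · exact Or.inl (Or.inl h)
        · by_cases hu : u = v
          · left; right; left; exact hu
          · exact Or.inr ⟨h, hu⟩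
      · rcases g1.2 a b hab with ⟨h1, h2⟩ | ⟨h1, h2⟩
        · exact Or.inl ⟨Or.inl h1, Or.inl h2⟩
        · by_cases ha : a = v
          · subst ha
            exact Or.inl ⟨Or.inr (Or.inl rfl), Or.inr (Or.inr hab)⟩
          · by_cases hb : b = v
            · subst hb
              exact Or.inl ⟨Or.inr (Or.inr hab.symm), Or.inr (Or.inl rfl)⟩
            · exact Or.inr ⟨⟨h1, ha⟩, h2, hb⟩
    have ho : ((A₀ ∪ insert v (H.neighborSet v)) ∩ (B₀ \ {v})).ncard + 1 ≤ 4 * r + Δ := by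
      have : (A₀ ∪ insert v (H.neighborSet v)) ∩ (B₀ \ {v}) ⊆ (A₀ ∩ B₀) ∪ H.neighborSet v := by
        rintro u ⟨h1 | h1 | h1, h2, h3⟩
        · exact Or.inl ⟨h1, h2⟩
        · exact absurd h1 h3
        · exact Or.inr h1
      have := (Set.ncard_le_ncard this (Set.toFinite _)).trans (Set.ncard_union_le _ _)
      omega
    refine ⟨_, _, ⟨hsep', fun u hu => ?_, ?_, ?_⟩, ho⟩
    · rcases hLv u hu with h | h
      · exact Or.inr (Or.inl h)
      · exact Or.inl (g2 h)
    · rw [Set.disjoint_left]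
      rintro u hu ⟨h1, h2⟩
      rcases hLv u hu with h | h
      · exact h2 h
      · exact Set.disjoint_left.1 g3 h h1
    · rcases hsep _ _ hsep' (by omega) with h | h
      · exfalso
        have hsub : W ⊆ (W \ (A₀ ∪ insert v (H.neighborSet v))) ∪ (W \ B₀) ∪ (A₀ ∩ B₀) ∪
            insert v (H.neighborSet v) := by
          intro u hu
          by_cases h1 : u ∈ insert v (H.neighborSet v)
          · exact Or.inr h1
          · simp only [mem_union, mem_sdiff, mem_inter_iff, hu, h1]
            tauto
        have h1 := Set.ncard_le_ncard hsub (Set.toFinite _)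
        have h2 := Set.ncard_union_le ((W \ (A₀ ∪ insert v (H.neighborSet v))) ∪ (W \ B₀) ∪
          (A₀ ∩ B₀)) (insert v (H.neighborSet v))
        have h3 := Set.ncard_union_le ((W \ (A₀ ∪ insert v (H.neighborSet v))) ∪ (W \ B₀))
          (A₀ ∩ B₀)
        have h4 := Set.ncard_union_le (W \ (A₀ ∪ insert v (H.neighborSet v))) (W \ B₀)
        have h5 := Set.ncard_insert_le v (H.neighborSet v)
        omega
      · exact h
  -- a good separation of minimum order
  have hQ : ∃ q, ∃ A B, Good s A B ∧ (A ∩ B).ncard = q := ⟨_, A₁, B₁, hg₁, rfl⟩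
  obtain ⟨A, B, hAB, hq⟩ := Nat.find_spec hQ
  have hqmin : ∀ A' B', Good s A' B' → Nat.find hQ ≤ (A' ∩ B').ncard := fun A' B' h =>
    Nat.find_min' hQ ⟨A', B', h, rfl⟩
  generalize Nat.find hQ = q at hq hqmin
  have hq1 : 4 * r ≤ q := hq ▸ hs2 A B hAB
  have hq2 : q + 1 ≤ 4 * r + Δ := (Nat.succ_le_succ (hqmin _ _ hg₁)).trans ho₁
  obtain ⟨hS, hLA, hLB, hWB⟩ := hAB
  have hLB' : ∀ u ∈ L, u ∉ B := fun u hu h => Set.disjoint_left.1 hLB hu h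
  let t : ℝ := (x v + s) / 2
  have hvs : x v < s := hvL
  have htL : ∀ u ∈ L, x u < t := fun u hu => by
    have := hvmax u hu; simp only [t]; linarith
  have htR : ∀ u, u ∉ L → t < x u := fun u hu => by
    have : s ≤ x u := not_lt.1 hu
    simp only [t]; linarith
  let bd : Set V := {d | d ∉ L ∧ ∃ l ∈ L, H.Adj l d}
  have hbdA : bd ⊆ A := by
    rintro d ⟨-, l, hl, hld⟩
    rcases hS.2 l d hld with h | h
    · exact h.2
    · exact absurd h.1 (hLB' l hl)
  obtain ⟨R, hRd, hR⟩ : HasLinkage (restrict H (A \ L)) bd (A ∩ B) q := by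
    refine (menger q _ _ _).resolve_right ?_
    rintro ⟨C, D, hCD, hC, hD, hcard⟩
    have hgood : Good s (L ∪ (C ∩ A)) (B ∪ ((D ∩ A) \ L)) := by
      refine ⟨⟨fun u => ?_, fun a b hab => ?_⟩, subset_union_left, ?_, ?_⟩
      · have h1 := hS.1 u
        have h2 := hCD.1 u
        simp only [mem_union, mem_inter_iff, mem_sdiff]
        tauto
      · have key : ∀ a b, H.Adj a b → a ∈ L → b ∈ A → b ∈ L ∪ (C ∩ A) := by
          intro a b hab ha hb
          by_cases hbL : b ∈ L
          · exact Or.inl hbL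
          · exact Or.inr ⟨hC ⟨hbL, a, ha, hab⟩, hb⟩
        rcases hS.2 a b hab with ⟨h1, h2⟩ | ⟨h1, h2⟩
        · by_cases ha : a ∈ L
          · exact Or.inl ⟨Or.inl ha, key a b hab ha h2⟩
          · by_cases hb : b ∈ L
            · exact Or.inl ⟨key b a hab.symm hb h1, Or.inl hb⟩
            · rcases hCD.2 a b ⟨hab, ⟨h1, ha⟩, h2, hb⟩ with ⟨h3, h4⟩ | ⟨h3, h4⟩
              · exact Or.inl ⟨Or.inr ⟨h3, h1⟩, Or.inr ⟨h4, h2⟩⟩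
              · exact Or.inr ⟨Or.inr ⟨⟨h3, h1⟩, ha⟩, Or.inr ⟨⟨h4, h2⟩, hb⟩⟩
        · exact Or.inr ⟨Or.inl h1, Or.inl h2⟩
      · rw [Set.disjoint_left]
        rintro u hu (h | h)
        · exact hLB' u hu h
        · exact h.2 hu
      · refine lt_of_le_of_lt (Set.ncard_le_ncard ?_ (Set.toFinite _)) hWB
        exact fun u hu => ⟨hu.1, fun h => hu.2 (Or.inl h)⟩
    have h1 := hqmin _ _ hgood
    have h2 : (L ∪ (C ∩ A)) ∩ (B ∪ ((D ∩ A) \ L)) ⊆ C ∩ D := by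
      rintro u ⟨h | ⟨h1, h2⟩, h3 | ⟨⟨h3, h4⟩, h5⟩⟩
      · exact absurd h3 (hLB' u h)
      · exact absurd h h5
      · exact ⟨h1, hD ⟨h2, h3⟩⟩
      · exact ⟨h1, h3⟩
    have h3 := Set.ncard_le_ncard h2 (Set.toFinite _)
    omega
  choose d hdb e heX hde using hR
  choose hdL l hlL hld using hdb
  have heR : ∀ i, e i ∈ R i := fun i => (hde i).right_mem
  have hdR : ∀ i, d i ∈ R i := fun i => (hde i).left_mem
  have hrange := exists_terminal_eq hRd heR heX hq
  have hRX : ∀ i, ∀ u ∈ R i, u ∈ A → u ∈ B → u = e i := by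
    intro i u hu hA hB
    have : u ∈ Set.range e := hrange ▸ ⟨hA, hB⟩
    obtain ⟨j, rfl⟩ := this
    by_contra hne
    exact Set.disjoint_left.1 (hRd i j (by rintro rfl; exact hne rfl)) hu (heR j)
  have hde' : ∀ i, Linked H (R i ∩ (A \ L)) (d i) (e i) := fun i =>
    (hde i).of_restrict ⟨hbdA ⟨hdL i, l i, hlL i, hld i⟩, hdL i⟩
  let h : Fin q → ℝ := fun i => hgt x y (l i) (d i) t
  have hdne : ∀ i j, i ≠ j → d i ≠ d j := fun i j hij h' =>
    Set.disjoint_left.1 (hRd i j hij) (hdR i) (h' ▸ hdR j)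
  have hinj : Function.Injective h := by
    intro i j hij
    by_contra hne
    have hin : ∀ i, InRange x (l i) (d i) t := fun i =>
      Or.inl ⟨(htL _ (hlL i)).le, (htR _ (hdL i)).le⟩
    have := hd.hgt_ne (hld i) (hld j) (hdne i j hne) (fun h => hdL j (h ▸ hlL i))
      (fun h => hdL i (h ▸ hlL j)) (hin i) (hin j) hij
    exact (htL _ (hlL i)).ne this.2
  let σ := Tuple.sort h
  have hmono : StrictMono (h ∘ σ) :=
    (Tuple.monotone_sort h).strictMono_of_injective (hinj.comp σ.injective)
  have heinj : Function.Injective e := fun i j hij => by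
    by_contra hne
    exact Set.disjoint_left.1 (hRd i j hne) (heR i) (hij ▸ heR j)
  refine ⟨restrict H B, q, e ∘ σ, restrict_le _ _, hq1, ?_, ?_⟩
  · intro a b c f hab hbc hcf C D hC hD hdisj
    have hC' := hC.of_restrict (heX (σ a)).2
    have hD' := hD.of_restrict (heX (σ b)).2
    have dis := Set.disjoint_left.1 hdisj
    have full : ∀ (C : Set V) i j, Linked H (C ∩ B) (e i) (e j) →
        Linked H ((R i ∩ (A \ L)) ∪ (C ∩ B) ∪ (R j ∩ (A \ L))) (d i) (d j) := by
      intro C i j hl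
      exact (((hde' i).mono (fun u hu => Or.inl (Or.inl hu))).trans
        (hl.mono (fun u hu => Or.inl (Or.inr hu)))).trans
        ((hde' j).symm.mono (fun u hu => Or.inr hu))
    have hx : ∀ (C : Set V) i j, ∀ u ∈ (R i ∩ (A \ L)) ∪ (C ∩ B) ∪ (R j ∩ (A \ L)), t < x u := by
      rintro C i j u ((⟨-, -, hu⟩ | ⟨-, hu⟩) | ⟨-, -, hu⟩)
      · exact htR u hu
      · exact htR u (fun h => hLB' u h hu)
      · exact htR u hu
    have hRR : ∀ i j, i ≠ j → ∀ u, u ∈ R (σ i) → u ∉ R (σ j) := fun i j hij u =>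
      fun h1 h2 => Set.disjoint_left.1 (hRd _ _ (σ.injective.ne hij)) h1 h2
    have hRC : ∀ (C : Set V) i, e i ∉ C → ∀ u, u ∈ R i → u ∈ A → u ∈ C → u ∉ B := by
      intro C i hi u h1 h2 h3 h4
      exact hi (hRX i u h1 h2 h4 ▸ h3)
    have eaC : e (σ a) ∉ D := dis hC.left_mem
    have ecC : e (σ c) ∉ D := dis hC.right_mem
    have ebD : e (σ b) ∉ C := fun h => dis h hD.left_mem
    have efD : e (σ f) ∉ C := fun h => dis h hD.right_mem
    refine hd.crossing (hx C (σ a) (σ c)) (hx D (σ b) (σ f)) ?_ (htL _ (hlL (σ a)))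
      (htL _ (hlL (σ b))) (htL _ (hlL (σ c))) (htL _ (hlL (σ f))) (hld _) (hld _) (hld _) (hld _)
      (full C _ _ hC') (full D _ _ hD') (hmono hab) (hmono hbc) (hmono hcf)
    rw [Set.disjoint_left]
    rintro u ((⟨h1, h2, -⟩ | ⟨h1, h2⟩) | ⟨h1, h2, -⟩) ((⟨h3, h4, -⟩ | ⟨h3, h4⟩) | ⟨h3, h4, -⟩)
    · exact hRR a b hab.ne u h1 h3
    · exact hRC D _ eaC u h1 h2 h3 h4
    · exact hRR a f (hab.trans (hbc.trans hcf)).ne u h1 h3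
    · exact hRC C _ ebD u h3 h4 h1 h2
    · exact dis h1 h3
    · exact hRC C _ efD u h3 h4 h1 h2
    · exact hRR c b hbc.ne' u h1 h3
    · exact hRC D _ ecC u h1 h2 h3 h4
    · exact hRR c f hcf.ne u h1 h3
  · intro I J hI hJ
    refine (menger r _ _ _).resolve_right ?_
    rintro ⟨C, D, hCD, hIC, hJD, hcard⟩
    have hinj' : Function.Injective (e ∘ σ) := heinj.comp σ.injective
    have main : ∀ (K : Set (Fin q)) (C D : Set V), r ≤ K.ncard → IsSep (restrict H B) C D →
        (e ∘ σ) '' K ⊆ D → (C ∩ D).ncard < r → (W \ (A ∪ D)).ncard < 4 * r + Δ := by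
      intro K C D hK hCD hKD hcard
      have hsep' : IsSep H (A ∪ D) (C ∩ B) := by
        refine ⟨fun u => ?_, fun a b hab => ?_⟩
        · have h1 := hS.1 u
          have h2 := hCD.1 u
          simp only [mem_union, mem_inter_iff]
          tauto
        · rcases hS.2 a b hab with ⟨h1, h2⟩ | ⟨h1, h2⟩
          · exact Or.inl ⟨Or.inl h1, Or.inl h2⟩
          · rcases hCD.2 a b ⟨hab, h1, h2⟩ with ⟨h3, h4⟩ | ⟨h3, h4⟩
            · exact Or.inr ⟨⟨h3, h1⟩, h4, h2⟩
            · exact Or.inl ⟨Or.inr h3, Or.inr h4⟩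
      have ho : ((A ∪ D) ∩ (C ∩ B)).ncard < q := by
        have hsub : (A ∪ D) ∩ (C ∩ B) ⊆ ((A ∩ B) \ ((e ∘ σ) '' K)) ∪ (C ∩ D) := by
          rintro u ⟨h1, h2, h3⟩
          by_cases hu : u ∈ D
          · exact Or.inr ⟨h2, hu⟩
          · exact Or.inl ⟨⟨h1.resolve_right hu, h3⟩, fun h => hu (hKD h)⟩
        have h1 := (Set.ncard_le_ncard hsub (Set.toFinite _)).trans (Set.ncard_union_le _ _)
        have h2 : (e ∘ σ) '' K ⊆ A ∩ B := by
          rintro _ ⟨i, -, rfl⟩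
          exact heX _
        have h3 := Set.ncard_sdiff_add_ncard_of_subset h2 (Set.toFinite _)
        rw [Set.ncard_image_of_injective _ hinj'] at h3
        omega
      rcases hsep _ _ hsep' (by omega) with h | h
      · exact h
      · exfalso
        have := hqmin _ _ ⟨hsep', hLA.trans subset_union_left,
          Set.disjoint_left.2 (fun u hu h => hLB' u hu h.2), h⟩
        omega
    have m1 := main J C D hJ hCD hJD hcard
    have m2 := main I D C hI hCD.symm hIC (by rwa [inter_comm])
    have hsub : W ⊆ (W \ (A ∪ D)) ∪ (W \ (A ∪ C)) ∪ (W \ B) ∪ (A ∩ B) ∪ (C ∩ D) := by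
      intro u hu
      simp only [mem_union, mem_sdiff, mem_inter_iff]
      tauto
    have h1 := Set.ncard_le_ncard hsub (Set.toFinite _)
    have h2 := Set.ncard_union_le ((W \ (A ∪ D)) ∪ (W \ (A ∪ C)) ∪ (W \ B) ∪ (A ∩ B)) (C ∩ D)
    have h3 := Set.ncard_union_le ((W \ (A ∪ D)) ∪ (W \ (A ∪ C)) ∪ (W \ B)) (A ∩ B)
    have h4 := Set.ncard_union_le ((W \ (A ∪ D)) ∪ (W \ (A ∪ C))) (W \ B)
    have h5 := Set.ncard_union_le (W \ (A ∪ D)) (W \ (A ∪ C))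
    omega

end
section
variable {V : Type} {H : SimpleGraph V}

/-- `p` restricted to `[0, n]` is a path of `H`. -/
structure IsPathOn (H : SimpleGraph V) (p : ℕ → V) (n : ℕ) : Prop where
  adj : ∀ i < n, H.Adj (p i) (p (i + 1))
  inj : ∀ i j, i ≤ n → j ≤ n → p i = p j → i = j

/-- The vertices `p t` with `lo ≤ t ≤ hi`. -/
def seg (p : ℕ → V) (lo hi : ℕ) : Set V := p '' Set.Icc lo hi

theorem mem_seg {p : ℕ → V} {lo hi t : ℕ} (h1 : lo ≤ t) (h2 : t ≤ hi) : p t ∈ seg p lo hi :=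
  ⟨t, ⟨h1, h2⟩, rfl⟩

theorem linked_seg {p : ℕ → V} {lo hi s t : ℕ}
    (h : ∀ k, lo ≤ k → k < hi → H.Adj (p k) (p (k + 1)))
    (hs : lo ≤ s) (hs' : s ≤ hi) (ht : lo ≤ t) (ht' : t ≤ hi) :
    Linked H (seg p lo hi) (p s) (p t) := by
  have key : ∀ t, lo ≤ t → t ≤ hi → Linked H (seg p lo hi) (p lo) (p t) := by
    intro t ht
    induction t, ht using Nat.le_induction with
    | base => intro h1; exact Linked.refl (mem_seg le_rfl h1)
    | succ t ht ih =>
      intro h1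
      exact (ih (by omega)).trans (Linked.of_adj (h t ht (by omega)) (mem_seg ht (by omega))
        (mem_seg (by omega) h1))
  exact (key s hs hs').symm.trans (key t ht ht')

theorem IsPathOn.linked {p : ℕ → V} {n lo hi s t : ℕ} (h : IsPathOn H p n) (hn : hi ≤ n)
    (hs : lo ≤ s) (hsb : s ≤ hi) (ht : lo ≤ t) (htb : t ≤ hi) :
    Linked H (seg p lo hi) (p s) (p t) :=
  linked_seg (fun k _ h2 => h.adj k (by omega)) hs hsb ht htb

/-- `C` and `D` cannot both be linked without meeting: terminals `a, a', b', b` occur in this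
cyclic order. -/
def Crosses (H : SimpleGraph V) (a c b d : V) : Prop :=
  ∀ C D, Linked H C a c → Linked H D b d → ¬ Disjoint C D

theorem Crosses.false {a c b d : V} (h : Crosses H a c b d) {C D : Set V}
    (hC : Linked H C a c) (hD : Linked H D b d) (hCD : ∀ v ∈ C, v ∉ D) : False :=
  h C D hC hD (Set.disjoint_left.2 hCD)

/-- A detour `f` of the path `p` around a vertex from which the path `g` leads to the terminal
`g m` does not meet a later path `p'`. -/
theorem detour_disjoint {p p' f g : ℕ → V} {n n' l m a b ξ : ℕ}
    (hp : IsPathOn H p n) (hp' : IsPathOn H p' n')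
    (hpp' : ∀ s ≤ n, ∀ t ≤ n', p s ≠ p' t)
    (hf : ∀ k < l, H.Adj (f k) (f (k + 1))) (hg : ∀ k < m, H.Adj (g k) (g (k + 1)))
    (haξ : a < ξ) (hξb : ξ < b) (hbn : b ≤ n) (hf0 : f 0 = p a) (hfl : f l = p b)
    (hfp : ∀ k, 0 < k → k < l → ∀ t ≤ n, f k ≠ p t)
    (hg0 : g 0 = p ξ) (hgp : ∀ k, 0 < k → k ≤ m → ∀ t ≤ n, g k ≠ p t)
    (hfg : ∀ k ≤ l, ∀ t ≤ m, f k ≠ g t)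
    (X1 : Crosses H (p 0) (g m) (p' 0) (p' n'))
    (X2 : Crosses H (p 0) (p' n') (p' 0) (p n)) :
    ∀ k ≤ l, ∀ t ≤ n', f k ≠ p' t := by
  classical
  by_contra! hcon
  obtain ⟨k₀, hk₀, t₀, ht₀, hkt₀⟩ := hcon
  have hex : ∃ t, t ≤ n' ∧ ∃ k ≤ l, f k = p' t := ⟨t₀, ht₀, k₀, hk₀, hkt₀⟩
  obtain ⟨hc1n, kc, hkc, hfc⟩ := Nat.find_spec hex
  have hcmin : ∀ t, t < Nat.find hex → ∀ k ≤ l, f k ≠ p' t := fun t ht k hk h =>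
    Nat.find_min hex ht ⟨by omega, k, hk, h⟩
  generalize Nat.find hex = c1 at hc1n hfc hcmin
  obtain ⟨d1, hd1n, kd, hkd, hfd, hdmax⟩ : ∃ d1, d1 ≤ n' ∧ ∃ kd ≤ l, f kd = p' d1 ∧
      ∀ t, d1 < t → t ≤ n' → ∀ k ≤ l, f k ≠ p' t := by
    have hP := Nat.findGreatest_spec (P := fun t => ∃ k ≤ l, f k = p' t) ht₀ ⟨k₀, hk₀, hkt₀⟩
    obtain ⟨k, hk, hk'⟩ := hP
    refine ⟨_, Nat.findGreatest_le n', k, hk, hk', fun t h1 h2 k hk h3 => ?_⟩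
    exact Nat.findGreatest_is_greatest h1 h2 ⟨k, hk, h3⟩
  have hcd : c1 ≤ d1 := by
    by_contra h
    exact hcmin d1 (by omega) kd hkd hfd
  have hint : ∀ k ≤ l, ∀ t ≤ n', f k = p' t → 0 < k ∧ k < l := by
    intro k hk t ht h
    constructor
    · by_contra h0
      have : k = 0 := by omega
      subst this
      exact hpp' a (by omega) t ht (hf0.symm.trans h)
    · by_contra h0
      have : k = l := by omega
      subst this
      exact hpp' b hbn t ht (hfl.symm.trans h)
  obtain ⟨hkc0, hkcl⟩ := hint kc hkc c1 hc1n hfc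
  obtain ⟨hkd0, hkdl⟩ := hint kd hkd d1 hd1n hfd
  have lf : ∀ {lo hi s t}, hi ≤ l → lo ≤ s → s ≤ hi → lo ≤ t → t ≤ hi →
      Linked H (seg f lo hi) (f s) (f t) := fun h1 h2 h3 h4 h5 =>
    linked_seg (fun k _ h' => hf k (by omega)) h2 h3 h4 h5
  have lg : ∀ {hi}, hi ≤ m → Linked H (seg g 0 hi) (g 0) (g hi) := fun h1 =>
    linked_seg (fun k _ h' => hg k (by omega)) le_rfl (by omega) (by omega) le_rfl
  by_cases hhit : ∃ k, k ≤ m ∧ ∃ t ≤ n', (t < c1 ∨ d1 < t) ∧ g k = p' t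
  · obtain ⟨hkm, ω, hω, hω', hgω⟩ := Nat.find_spec hhit
    have hmin : ∀ k, k < Nat.find hhit → ∀ t ≤ n', (t < c1 ∨ d1 < t) → g k ≠ p' t :=
      fun k hk t ht h1 h2 => Nat.find_min hhit hk ⟨by omega, t, ht, h1, h2⟩
    generalize Nat.find hhit = k at hkm hgω hmin
    rcases hω' with hω' | hω'
    · refine X2.false (C := seg p 0 a ∪ seg f 0 kd ∪ seg p' d1 n')
        (D := seg p' 0 ω ∪ seg g 0 k ∪ seg p ξ n) ?_ ?_ ?_
      · refine Linked.trans (Linked.trans (v := p a) ?_ ?_) (v := p' d1) ?_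
        · exact (hp.linked (by omega) le_rfl (by omega) (by omega) le_rfl).mono
            (fun v hv => Or.inl (Or.inl hv))
        · rw [← hf0, ← hfd]
          exact (lf hkd le_rfl (by omega) (by omega) le_rfl).mono
            (fun v hv => Or.inl (Or.inr hv))
        · exact (hp'.linked le_rfl le_rfl hd1n hd1n le_rfl).mono (fun v hv => Or.inr hv)
      · refine Linked.trans (Linked.trans (v := p' ω) ?_ ?_) (v := p ξ) ?_
        · exact (hp'.linked hω le_rfl (by omega) (by omega) le_rfl).mono
            (fun v hv => Or.inl (Or.inl hv))
        · rw [← hg0, ← hgω]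
          exact (lg hkm).symm.mono (fun v hv => Or.inl (Or.inr hv))
        · exact (hp.linked le_rfl le_rfl (by omega) (by omega) le_rfl).mono
            (fun v hv => Or.inr hv)
      · rintro v ((⟨t, ht, rfl⟩ | ⟨t, ht, rfl⟩) | ⟨t, ht, rfl⟩)
          ((⟨s, hs, h⟩ | ⟨s, hs, h⟩) | ⟨s, hs, h⟩) <;> rw [Set.mem_Icc] at hs ht
        · exact hpp' t (by omega) s (by omega) h.symm
        · by_cases hs0 : s = 0
          · subst hs0
            have := hp.inj ξ t (by omega) (by omega) (hg0 ▸ h)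
            omega
          · exact hgp s (by omega) (by omega) t (by omega) h
        · have := hp.inj s t (by omega) (by omega) h
          omega
        · exact hcmin s (by omega) t (by omega) h.symm
        · exact hfg t (by omega) s (by omega) h.symm
        · by_cases ht0 : t = 0
          · subst ht0
            have := hp.inj s a (by omega) (by omega) (h.trans hf0)
            omega
          · exact hfp t (by omega) (by omega) s (by omega) h.symm
        · have := hp'.inj s t (by omega) (by omega) h
          omega
        · by_cases htd : t = d1
          · subst htd
            exact hfg kd hkd s (by omega) (hfd.trans h.symm)
          · by_cases hsk : s = k
            · subst hsk
              have := hp'.inj ω t (by omega) (by omega) (hgω.symm.trans h)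
              omega
            · exact hmin s (by omega) t (by omega) (Or.inr (by omega)) h
        · exact hpp' s (by omega) t (by omega) h
    · refine X2.false (C := seg p 0 ξ ∪ seg g 0 k ∪ seg p' ω n')
        (D := seg p' 0 c1 ∪ seg f kc l ∪ seg p b n) ?_ ?_ ?_
      · refine Linked.trans (Linked.trans (v := p ξ) ?_ ?_) (v := p' ω) ?_
        · exact (hp.linked (by omega) le_rfl (by omega) (by omega) le_rfl).mono
            (fun v hv => Or.inl (Or.inl hv))
        · rw [← hg0, ← hgω]
          exact (lg hkm).mono (fun v hv => Or.inl (Or.inr hv))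
        · exact (hp'.linked le_rfl le_rfl hω hω le_rfl).mono (fun v hv => Or.inr hv)
      · refine Linked.trans (Linked.trans (v := p' c1) ?_ ?_) (v := p b) ?_
        · exact (hp'.linked hc1n le_rfl (by omega) (by omega) le_rfl).mono
            (fun v hv => Or.inl (Or.inl hv))
        · rw [← hfl, ← hfc]
          exact (lf le_rfl le_rfl hkc hkc le_rfl).mono (fun v hv => Or.inl (Or.inr hv))
        · exact (hp.linked le_rfl le_rfl (by omega) (by omega) le_rfl).mono
            (fun v hv => Or.inr hv)
      · rintro v ((⟨t, ht, rfl⟩ | ⟨t, ht, rfl⟩) | ⟨t, ht, rfl⟩)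
          ((⟨s, hs, h⟩ | ⟨s, hs, h⟩) | ⟨s, hs, h⟩) <;> rw [Set.mem_Icc] at hs ht
        · exact hpp' t (by omega) s (by omega) h.symm
        · by_cases hsl : s = l
          · subst hsl
            have := hp.inj b t (by omega) (by omega) (hfl.symm.trans h)
            omega
          · exact hfp s (by omega) (by omega) t (by omega) h
        · have := hp.inj s t (by omega) (by omega) h
          omega
        · by_cases hsc : s = c1
          · subst hsc
            exact hfg kc hkc t (by omega) (hfc.trans h)
          · by_cases htk : t = k
            · subst htk
              have := hp'.inj ω s (by omega) (by omega) (hgω.symm.trans h.symm)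
              omega
            · exact hmin t (by omega) s (by omega) (Or.inl (by omega)) h.symm
        · exact hfg s (by omega) t (by omega) h
        · by_cases ht0 : t = 0
          · subst ht0
            have := hp.inj s ξ (by omega) (by omega) (h.trans hg0)
            omega
          · exact hgp t (by omega) (by omega) s (by omega) h.symm
        · have := hp'.inj s t (by omega) (by omega) h
          omega
        · exact hdmax t (by omega) (by omega) s (by omega) h
        · exact hpp' s (by omega) t (by omega) h
  · push Not at hhit
    refine X1.false (C := seg p 0 ξ ∪ seg g 0 m)
      (D := seg p' 0 c1 ∪ seg f 1 (l - 1) ∪ seg p' d1 n') ?_ ?_ ?_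
    · refine Linked.trans (v := p ξ) ?_ ?_
      · exact (hp.linked (by omega) le_rfl (by omega) (by omega) le_rfl).mono
          (fun v hv => Or.inl hv)
      · rw [← hg0]
        exact (lg le_rfl).mono (fun v hv => Or.inr hv)
    · refine Linked.trans (Linked.trans (v := p' c1) ?_ ?_) (v := p' d1) ?_
      · exact (hp'.linked hc1n le_rfl (by omega) (by omega) le_rfl).mono
          (fun v hv => Or.inl (Or.inl hv))
      · rw [← hfd, ← hfc]
        exact (lf (by omega) (by omega) (by omega) (by omega) (by omega)).mono
          (fun v hv => Or.inl (Or.inr hv))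
      · exact (hp'.linked le_rfl le_rfl hd1n hd1n le_rfl).mono (fun v hv => Or.inr hv)
    · rintro v (⟨t, ht, rfl⟩ | ⟨t, ht, rfl⟩)
        ((⟨s, hs, h⟩ | ⟨s, hs, h⟩) | ⟨s, hs, h⟩) <;> rw [Set.mem_Icc] at hs ht
      · exact hpp' t (by omega) s (by omega) h.symm
      · exact hfp s (by omega) (by omega) t (by omega) h
      · exact hpp' t (by omega) s (by omega) h.symm
      · by_cases hsc : s = c1
        · subst hsc
          exact hfg kc hkc t (by omega) (hfc.trans h)
        · exact hhit t (by omega) s (by omega) (Or.inl (by omega)) h.symm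
      · exact hfg s (by omega) t (by omega) h
      · by_cases hsd : s = d1
        · subst hsd
          exact hfg kd hkd t (by omega) (hfd.trans h)
        · exact hhit t (by omega) s (by omega) (Or.inr (by omega)) h.symm

end
section
variable {V : Type} {H : SimpleGraph V} {r : ℕ} {p q : ℕ → ℕ → V} {n m : ℕ → ℕ}

/-- Two families of `r` disjoint paths. The ends of the paths `p i`, and the ends of the paths
`q j`, occur around a society in the order `p 0 0, …, p (r - 1) 0`, ends of the `q j`, last
vertices of `p (r - 1), …, p 0`, starts of the `q j`. -/
structure Weave (H : SimpleGraph V) (r : ℕ) (p q : ℕ → ℕ → V) (n m : ℕ → ℕ) : Prop where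
  isPath_left : ∀ i < r, IsPathOn H (p i) (n i)
  isPath_right : ∀ j < r, IsPathOn H (q j) (m j)
  disj_left : ∀ i < r, ∀ i' < r, ∀ s ≤ n i, ∀ t ≤ n i', p i s = p i' t → i = i'
  disj_right : ∀ j < r, ∀ k < r, ∀ s ≤ m j, ∀ t ≤ m k, q j s = q k t → j = k
  crosses_tail : ∀ i i' j, i < i' → i' < r → j < r →
    Crosses H (p i 0) (q j (m j)) (p i' 0) (p i' (n i'))
  crosses_swap : ∀ i i', i < i' → i' < r → Crosses H (p i 0) (p i' (n i')) (p i' 0) (p i (n i))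
  crosses : ∀ i < r, ∀ j < r, Crosses H (q j 0) (q j (m j)) (p i 0) (p i (n i))
  crosses_mid : ∀ i k l, i < k → k < l → l < r →
    Crosses H (p i 0) (p l (n l)) (p k 0) (p k (n k))

/-- The edges of a family of paths. -/
def pathEdges (r : ℕ) (p : ℕ → ℕ → V) (n : ℕ → ℕ) : Set (Sym2 V) :=
  {e | ∃ i < r, ∃ t < n i, e = s(p i t, p i (t + 1))}

/-- A weave whose left paths use as few edges outside of the right paths as possible. -/
structure TightWeave (H : SimpleGraph V) (r : ℕ) (p q : ℕ → ℕ → V) (n m : ℕ → ℕ) : Prop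
    extends Weave H r p q n m where
  tight : ∀ p' n', Weave H r p' q n' m →
    ¬ pathEdges r p' n' \ pathEdges r q m ⊂ pathEdges r p n \ pathEdges r q m

theorem Weave.exists_tight [Finite V] (h : Weave H r p q n m) :
    ∃ p' n', TightWeave H r p' q n' m := by
  induction hc : (pathEdges r p n \ pathEdges r q m).ncard using Nat.strong_induction_on
    generalizing p n with
  | _ c ih =>
  by_cases hex : ∃ p' n', Weave H r p' q n' m ∧
      pathEdges r p' n' \ pathEdges r q m ⊂ pathEdges r p n \ pathEdges r q m
  · obtain ⟨p', n', h', hlt⟩ := hex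
    have : Finite (Sym2 V) := inferInstanceAs (Finite (Quot _))
    exact ih _ (hc ▸ Set.ncard_lt_ncard hlt (Set.toFinite _)) h' rfl
  · push Not at hex
    exact ⟨p, n, h, hex⟩

theorem Weave.update (h : Weave H r p q n m) {i : ℕ} (hi : i < r) {p' : ℕ → V} {n' : ℕ}
    (hp' : IsPathOn H p' n') (h0 : p' 0 = p i 0) (hn : p' n' = p i (n i))
    (hd : ∀ i' < r, i' ≠ i → ∀ s ≤ n', ∀ t ≤ n i', p' s ≠ p i' t) :
    Weave H r (Function.update p i p') q (Function.update n i n') m := by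
  have e0 : ∀ k, Function.update p i p' k 0 = p k 0 := fun k => by
    by_cases hk : k = i
    · subst hk; simp [h0]
    · simp [hk]
  have en : ∀ k, Function.update p i p' k (Function.update n i n' k) = p k (n k) := fun k => by
    by_cases hk : k = i
    · subst hk; simp [hn]
    · simp [hk]
  refine ⟨fun k hk => ?_, h.isPath_right, fun k hk l hl s hs t ht hst => ?_, h.disj_right,
    ?_, ?_, ?_, ?_⟩
  · by_cases hki : k = i
    · subst hki; simpa using hp'
    · simpa [hki] using h.isPath_left k hk
  · by_cases hki : k = i <;> by_cases hli : l = i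
    · rw [hki, hli]
    · subst hki
      simp only [Function.update_self, Function.update_of_ne hli] at hs ht hst
      exact absurd hst (hd l hl hli s hs t ht)
    · subst hli
      simp only [Function.update_self, Function.update_of_ne hki] at hs ht hst
      exact absurd hst.symm (hd k hk hki t ht s hs)
    · simp only [Function.update_of_ne hki, Function.update_of_ne hli] at hs ht hst
      exact h.disj_left k hk l hl s hs t ht hst
  all_goals simp only [e0, en]
  exacts [h.crosses_tail, h.crosses_swap, h.crosses, h.crosses_mid]

theorem pathEdges_update_subset {i : ℕ} (hi : i < r) {p' : ℕ → V} {n' : ℕ} :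
    pathEdges r (Function.update p i p') (Function.update n i n') ⊆
      {e | ∃ t < n', e = s(p' t, p' (t + 1))} ∪
        {e | ∃ k < r, k ≠ i ∧ ∃ t < n k, e = s(p k t, p k (t + 1))} := by
  rintro e ⟨k, hk, t, ht, rfl⟩
  by_cases hki : k = i
  · subst hki
    exact Or.inl ⟨t, by simpa using ht, by simp⟩
  · exact Or.inr ⟨k, hk, hki, t, by simpa [hki] using ht, by simp [hki]⟩

/-- A path of a tight weave cannot be shortcut along a segment of a right path. -/
theorem TightWeave.no_detour (h : TightWeave H r p q n m) {i j k a b ξ c d s : ℕ}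
    (hi : i < r) (hj : j < r) (hk : k < r) (hjk : j ≠ k) (haξ : a < ξ) (hξb : ξ < b)
    (hb : b ≤ n i) (hs : s ≤ m j) (hsξ : q j s = p i ξ) (hcd : c ≤ d) (hd : d ≤ m k)
    (hend : (q k c = p i a ∧ q k d = p i b) ∨ (q k c = p i b ∧ q k d = p i a))
    (hav : ∀ i' < r, i' ≠ i → ∀ t, c ≤ t → t ≤ d → ∀ u ≤ n i', q k t ≠ p i' u) : False := by
  set K : SimpleGraph V := SimpleGraph.fromEdgeSet
    ({e | ∃ t, t < n i ∧ (t < a ∨ b ≤ t) ∧ e = s(p i t, p i (t + 1))} ∪ pathEdges r q m) with hK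
  have hpi := h.isPath_left i hi
  have hqk := h.isPath_right k hk
  have KH : K ≤ H := by
    intro u v huv
    simp only [hK, fromEdgeSet_adj] at huv
    obtain ⟨⟨t, ht, -, he⟩ | ⟨l, hl, t, ht, he⟩, -⟩ := huv
    · have := hpi.adj t ht
      rw [← mem_edgeSet, ← he] at this
      exact this
    · have := (h.isPath_right l hl).adj t ht
      rw [← mem_edgeSet, ← he] at this
      exact this
  have hne : ∀ t < n i, p i t ≠ p i (t + 1) := fun t ht => (hpi.adj t ht).ne
  have hL : Linked K (seg (p i) 0 a ∪ seg (q k) c d ∪ seg (p i) b (n i)) (p i 0) (p i (n i)) := by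
    have hq' : Linked K (seg (q k) c d) (q k c) (q k d) := by
      refine linked_seg (fun t h1 h2 => ?_) le_rfl hcd hcd le_rfl
      rw [hK, fromEdgeSet_adj]
      exact ⟨Or.inr ⟨k, hk, t, by omega, rfl⟩, (hqk.adj t (by omega)).ne⟩
    have hq'' : Linked K (seg (q k) c d) (p i a) (p i b) := by
      rcases hend with ⟨h1, h2⟩ | ⟨h1, h2⟩
      · rwa [h1, h2] at hq'
      · rw [h1, h2] at hq'; exact hq'.symm
    refine Linked.trans (Linked.trans (v := p i a) ?_ (hq''.mono fun v hv => Or.inl (Or.inr hv)))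
      (v := p i b) ?_
    · refine (linked_seg (fun t h1 h2 => ?_) le_rfl (by omega) (by omega) le_rfl).mono
        fun v hv => Or.inl (Or.inl hv)
      rw [hK, fromEdgeSet_adj]
      exact ⟨Or.inl ⟨t, by omega, Or.inl h2, rfl⟩, hne t (by omega)⟩
    · refine (linked_seg (fun t h1 h2 => ?_) le_rfl (by omega) (by omega) le_rfl).mono
        fun v hv => Or.inr hv
      rw [hK, fromEdgeSet_adj]
      exact ⟨Or.inl ⟨t, by omega, Or.inr h1, rfl⟩, hne t (by omega)⟩
  obtain ⟨n', p', h0, hn', hadj, hinj, hmem⟩ := hL.exists_path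
  have hW := h.toWeave.update hi (p' := p') (n' := n') ⟨fun t ht => KH (hadj t ht), hinj⟩ h0 hn'
    (by
      intro i' hi' hne s hs t ht hst
      rcases hmem s hs with (⟨u, hu, hu'⟩ | ⟨u, hu, hu'⟩) | ⟨u, hu, hu'⟩ <;> rw [Set.mem_Icc] at hu
      · exact hne (h.disj_left i hi i' hi' u (by omega) t ht (hu'.trans hst)).symm
      · exact hav i' hi' hne u hu.1 hu.2 t ht (hu'.trans hst)
      · exact hne (h.disj_left i hi i' hi' u (by omega) t ht (hu'.trans hst)).symm)
  refine h.tight _ _ hW ⟨?_, fun hsub => ?_⟩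
  · rintro e ⟨he, hq⟩
    refine ⟨?_, hq⟩
    rcases pathEdges_update_subset hi he with ⟨t, ht, rfl⟩ | ⟨l, hl, -, t, ht, rfl⟩
    · have := hadj t ht
      rw [hK, fromEdgeSet_adj] at this
      rcases this.1 with ⟨u, hu, -, he⟩ | h'
      · exact ⟨i, hi, u, hu, he⟩
      · exact absurd h' hq
    · exact ⟨l, hl, t, ht, rfl⟩
  · have hall : ∀ t, a ≤ t → t < ξ → s(p i t, p i (t + 1)) ∈ pathEdges r q m := by
      intro t h1 h2
      by_contra hcon
      obtain ⟨he, -⟩ := hsub ⟨⟨i, hi, t, by omega, rfl⟩, hcon⟩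
      rcases pathEdges_update_subset hi he with ⟨u, hu, he⟩ | ⟨l, hl, hli, u, hu, he⟩
      · have := hadj u hu
        rw [hK, fromEdgeSet_adj, ← he] at this
        rcases this.1 with ⟨w, hw, hw', he'⟩ | h'
        · rw [Sym2.eq_iff] at he'
          rcases he' with ⟨h3, h4⟩ | ⟨h3, h4⟩
          · have := hpi.inj t w (by omega) (by omega) h3
            omega
          · have := hpi.inj _ _ (by omega) (by omega) h3
            have := hpi.inj _ _ (by omega) (by omega) h4
            omega
        · exact hcon h'
      · rw [Sym2.eq_iff] at he
        rcases he with ⟨h3, h4⟩ | ⟨h3, h4⟩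
        · exact hli (h.disj_left i hi l hl t (by omega) u (by omega) h3).symm
        · exact hli (h.disj_left i hi l hl t (by omega) (u + 1) (by omega) h3).symm
    have hon : ∀ t, a ≤ t → t ≤ ξ → ∃ u ≤ m k, p i t = q k u := by
      intro t ht
      induction t, ht using Nat.le_induction with
      | base =>
        intro _
        rcases hend with ⟨h1, h2⟩ | ⟨h1, h2⟩
        · exact ⟨c, by omega, h1.symm⟩
        · exact ⟨d, by omega, h2.symm⟩
      | succ t ht ih =>
        intro h1
        obtain ⟨u, hu, hu'⟩ := ih (by omega)
        obtain ⟨l, hl, w, hw, he⟩ := hall t ht (by omega)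
        rw [Sym2.eq_iff] at he
        rcases he with ⟨h3, h4⟩ | ⟨h3, h4⟩
        · have := h.disj_right k hk l hl u hu w (by omega) (hu'.symm.trans h3)
          subst this
          exact ⟨w + 1, by omega, h4⟩
        · have := h.disj_right k hk l hl u hu (w + 1) (by omega) (hu'.symm.trans h3)
          subst this
          exact ⟨w, by omega, h4⟩
    obtain ⟨u, hu, huξ⟩ := hon ξ (by omega) le_rfl
    exact hjk (h.disj_right j hj k hk s hs u hu (hsξ.trans huξ))

/-- A segment of the right path `q k` around the last vertex of `q j` on the left path `p i`
has to meet an earlier left path. -/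
theorem TightWeave.no_hump (h : TightWeave H r p q n m) {i j k a b ξ c d s : ℕ}
    (hi : i < r) (hj : j < r) (hk : k < r) (hjk : j ≠ k) (haξ : a < ξ) (hξb : ξ < b)
    (hb : b ≤ n i) (hs : s ≤ m j) (hsξ : q j s = p i ξ)
    (hlast : ∀ t, s < t → t ≤ m j → ∀ u ≤ n i, q j t ≠ p i u) (hcd : c ≤ d) (hd : d ≤ m k)
    (hend : (q k c = p i a ∧ q k d = p i b) ∨ (q k c = p i b ∧ q k d = p i a))
    (hin : ∀ t, c < t → t < d → ∀ u ≤ n i, q k t ≠ p i u)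
    (hav : ∀ i' < i, ∀ t, c ≤ t → t ≤ d → ∀ u ≤ n i', q k t ≠ p i' u) : False := by
  refine h.no_detour hi hj hk hjk haξ hξb hb hs hsξ hcd hd hend ?_
  intro i' hi' hne
  rcases lt_or_gt_of_ne hne with hlt | hgt
  · exact hav i' hlt
  have hqj := h.isPath_right j hj
  have hqk := h.isPath_right k hk
  have key : ∀ (f : ℕ → V), (∀ t < d - c, H.Adj (f t) (f (t + 1))) → f 0 = p i a →
      f (d - c) = p i b → (∀ t, 0 < t → t < d - c → ∀ u ≤ n i, f t ≠ p i u) →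
      (∀ t ≤ d - c, ∃ u ≤ m k, f t = q k u) →
      ∀ t ≤ d - c, ∀ u ≤ n i', f t ≠ p i' u := by
    intro f hf hf0 hfl hfp hfq
    refine detour_disjoint (g := fun t => q j (s + t)) (m := m j - s) (h.isPath_left i hi)
      (h.isPath_left i' hi') (fun s hs t ht e => hne (h.disj_left i hi i' hi' s hs t ht e).symm)
      hf (fun t ht => hqj.adj (s + t) (by omega)) haξ hξb hb hf0 hfl hfp hsξ
      (fun t h1 h2 => hlast (s + t) (by omega) (by omega)) ?_ ?_ (h.crosses_swap i i' hgt hi')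
    · intro t ht u hu e
      obtain ⟨w, hw, hw'⟩ := hfq t ht
      exact hjk (h.disj_right j hj k hk (s + u) (by omega) w hw (e.symm.trans hw'))
    · have : s + (m j - s) = m j := by omega
      simp only [this]
      exact h.crosses_tail i i' j hgt hi' hj
  intro t h1 h2
  rcases hend with ⟨h3, h4⟩ | ⟨h3, h4⟩
  · have := key (fun t => q k (c + t)) (fun t ht => hqk.adj (c + t) (by omega)) h3
      (by simpa [show c + (d - c) = d by omega] using h4)
      (fun t h5 h6 => hin (c + t) (by omega) (by omega)) (fun t ht => ⟨c + t, by omega, rfl⟩)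
      (t - c) (by omega)
    simpa [show c + (t - c) = t by omega] using this
  · have := key (fun t => q k (d - t)) (fun t ht => by
        have := hqk.adj (d - (t + 1)) (by omega)
        rw [show d - (t + 1) + 1 = d - t by omega] at this
        exact this.symm) h4
      (by simpa [show d - (d - c) = c by omega] using h3)
      (fun t h5 h6 => hin (d - t) (by omega) (by omega)) (fun t ht => ⟨d - t, by omega, rfl⟩)
      (d - t) (by omega)
    simpa [show d - (d - t) = t by omega] using this

end
section
variable {V : Type} {H : SimpleGraph V} {r : ℕ} {p q : ℕ → ℕ → V} {n m : ℕ → ℕ}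

/-- The last vertex of `q j` on the path `p i` is `q j (σ i j) = p i (S i j)`. -/
structure LastTouch (r : ℕ) (p q : ℕ → ℕ → V) (n m : ℕ → ℕ) (σ S : ℕ → ℕ → ℕ) : Prop where
  le_right : ∀ i < r, ∀ j < r, σ i j ≤ m j
  le_left : ∀ i < r, ∀ j < r, S i j ≤ n i
  eq : ∀ i < r, ∀ j < r, q j (σ i j) = p i (S i j)
  last : ∀ i < r, ∀ j < r, ∀ s, σ i j < s → s ≤ m j → ∀ u ≤ n i, q j s ≠ p i u

theorem Weave.exists_lastTouch (h : Weave H r p q n m) : ∃ σ S, LastTouch r p q n m σ S := by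
  classical
  have key : ∀ i j, i < r → j < r → ∃ s u, s ≤ m j ∧ u ≤ n i ∧ q j s = p i u ∧
      ∀ s', s < s' → s' ≤ m j → ∀ u ≤ n i, q j s' ≠ p i u := by
    intro i j hi hj
    have hex : ∃ s ≤ m j, ∃ u ≤ n i, q j s = p i u := by
      by_contra! hcon
      refine (h.crosses i hi j hj).false
        ((h.isPath_right j hj).linked le_rfl le_rfl (by omega) (by omega) le_rfl)
        ((h.isPath_left i hi).linked le_rfl le_rfl (by omega) (by omega) le_rfl) ?_
      rintro _ ⟨s, ⟨-, hs⟩, rfl⟩ ⟨t, ⟨-, ht⟩, e⟩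
      exact hcon s hs t ht e.symm
    obtain ⟨s, hs, hs'⟩ := hex
    obtain ⟨u, hu, e⟩ := Nat.findGreatest_spec (P := fun s => ∃ u ≤ n i, q j s = p i u) hs hs'
    refine ⟨_, u, Nat.findGreatest_le (m j), hu, e, fun s' h1 h2 u hu e' => ?_⟩
    exact Nat.findGreatest_is_greatest h1 h2 ⟨u, hu, e'⟩
  choose! σ S hσ using key
  exact ⟨σ, S, fun i hi j hj => (hσ i j hi hj).1, fun i hi j hj => (hσ i j hi hj).2.1,
    fun i hi j hj => (hσ i j hi hj).2.2.1, fun i hi j hj => (hσ i j hi hj).2.2.2⟩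

/-- The index after the last vertex of `q j` on `p (i - 1)`. -/
def level (σ : ℕ → ℕ → ℕ) (i j : ℕ) : ℕ := if i = 0 then σ 0 j else σ (i - 1) j + 1

variable {σ S : ℕ → ℕ → ℕ}

theorem Weave.last_lt (h : Weave H r p q n m) (hl : LastTouch r p q n m σ S) {i i' j : ℕ}
    (hii' : i < i') (hi' : i' < r) (hj : j < r) : σ i j < σ i' j := by
  by_contra! hcon
  have hi : i < r := by omega
  refine (h.crosses_tail i i' j hii' hi' hj).false
    (C := seg (p i) 0 (S i j) ∪ seg (q j) (σ i j) (m j)) (D := seg (p i') 0 (n i'))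
    (Linked.trans (v := p i (S i j)) ?_ ?_)
    ((h.isPath_left i' hi').linked le_rfl le_rfl (by omega) (by omega) le_rfl) ?_
  · exact ((h.isPath_left i hi).linked (hl.le_left i hi j hj) le_rfl (by omega) (by omega)
      le_rfl).mono fun v hv => Or.inl hv
  · rw [← hl.eq i hi j hj]
    exact ((h.isPath_right j hj).linked le_rfl le_rfl (hl.le_right i hi j hj)
      (hl.le_right i hi j hj) le_rfl).mono fun v hv => Or.inr hv
  · have h1 := hl.le_left i hi j hj
    have h2 := hl.le_right i hi j hj
    have h3 := hl.eq i hi j hj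
    rintro v (⟨s, ⟨-, hs⟩, rfl⟩ | ⟨s, ⟨hs, hs'⟩, rfl⟩) ⟨t, ⟨-, ht⟩, e⟩
    · have := h.disj_left i' hi' i hi t ht s (by omega) e
      omega
    · rcases eq_or_lt_of_le hs with rfl | hs
      · have := h.disj_left i' hi' i hi t ht _ h1 (e.trans h3)
        omega
      · exact hl.last i' hi' j hj s (by omega) hs' t ht e.symm

theorem Weave.last_le (h : Weave H r p q n m) (hl : LastTouch r p q n m σ S) {i i' j : ℕ}
    (hii' : i ≤ i') (hi' : i' < r) (hj : j < r) : σ i j ≤ σ i' j := by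
  rcases eq_or_lt_of_le hii' with rfl | hlt
  · rfl
  · exact (h.last_lt hl hlt hi' hj).le

theorem Weave.avoid_of_level_le (h : Weave H r p q n m) (hl : LastTouch r p q n m σ S)
    {i i' j s : ℕ} (hii' : i' < i) (hi : i < r) (hj : j < r) (hs : level σ i j ≤ s)
    (hsm : s ≤ m j) : ∀ u ≤ n i', q j s ≠ p i' u := by
  have : σ i' j < s := by
    rw [level, if_neg (by omega)] at hs
    have := h.last_le hl (show i' ≤ i - 1 by omega) (by omega) hj
    omega
  exact hl.last i' (by omega) j hj s this hsm

theorem Weave.level_le (h : Weave H r p q n m) (hl : LastTouch r p q n m σ S)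
    {i j : ℕ} (hi : i < r) (hj : j < r) : level σ i j ≤ σ i j := by
  rw [level]
  split_ifs with h0
  · subst h0; rfl
  · exact h.last_lt hl (by omega) hi hj

/-- All vertices on `p i` of the part of `q k` after its last visit to the previous left path are
on the same side of the last vertex of `q j` on `p i`. -/
theorem TightWeave.touch_side (h : TightWeave H r p q n m) (hl : LastTouch r p q n m σ S)
    {i j k t u : ℕ} (hi : i < r) (hj : j < r) (hk : k < r) (hjk : j ≠ k)
    (ht : level σ i k ≤ t) (ht' : t ≤ σ i k) (hu : u ≤ n i) (e : q k t = p i u) :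
    u < S i j ↔ S i k < S i j := by
  classical
  induction hd : σ i k - t using Nat.strong_induction_on generalizing t u with
  | _ d ih =>
  have hSk := hl.eq i hi k hk
  have hSj := hl.eq i hi j hj
  have h1 := hl.le_right i hi k hk
  have h2 := hl.le_left i hi k hk
  have h3 := hl.le_right i hi j hj
  have h4 := hl.le_left i hi j hj
  rcases eq_or_lt_of_le ht' with rfl | hlt
  · rw [(h.isPath_left i hi).inj u (S i k) hu h2 (e.symm.trans hSk)]
  have hex : ∃ t', t < t' ∧ ∃ u ≤ n i, q k t' = p i u := ⟨σ i k, hlt, _, h2, hSk⟩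
  obtain ⟨htt', u', hu', enext⟩ := Nat.find_spec hex
  have hle : Nat.find hex ≤ σ i k := Nat.find_min' hex ⟨hlt, _, h2, hSk⟩
  have hmin : ∀ s, t < s → s < Nat.find hex → ∀ u ≤ n i, q k s ≠ p i u := fun s h5 h6 u hu h7 =>
    Nat.find_min hex h6 ⟨h5, u, hu, h7⟩
  generalize Nat.find hex = t' at htt' enext hle hmin
  rw [← ih (σ i k - t') (by omega) (by omega) hle hu' enext rfl]
  have hne : ∀ w, w ≤ m k → ∀ v ≤ n i, q k w = p i v → v ≠ S i j := by
    rintro w hw v hv h5 rfl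
    exact hjk (h.disj_right j hj k hk _ h3 w hw (hSj.trans h5.symm))
  have hu1 := hne t (by omega) u hu e
  have hu2 := hne t' (by omega) u' hu' enext
  have hump := fun a b (ha : a < S i j) (hb : S i j < b) (hb' : b ≤ n i) hend =>
    h.no_hump (a := a) (b := b) hi hj hk hjk ha hb hb' h3 hSj (hl.last i hi j hj) htt'.le
      (by omega) hend hmin fun i' hi' s h5 h6 => h.avoid_of_level_le hl hi' hi hk (by omega)
        (by omega)
  constructor
  · intro h5
    by_contra h6
    exact hump u u' h5 (by omega) hu' (Or.inl ⟨e, enext⟩)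
  · intro h5
    by_contra h6
    exact hump u' u h5 (by omega) hu (Or.inr ⟨e, enext⟩)

/-- Right paths do not cross between two consecutive left paths. -/
theorem Weave.rung_lt (h : Weave H r p q n m) (hl : LastTouch r p q n m σ S)
    {i j k s t A B : ℕ} (hi : i + 1 < r) (hj : j < r) (hk : k < r) (hS : S i j < S i k)
    (hs : σ i j < s) (hsm : s ≤ m j) (ht : σ i k < t) (htm : t ≤ m k)
    (hA : A ≤ n (i + 1)) (hB : B ≤ n (i + 1)) (eA : q j s = p (i + 1) A) (eB : q k t = p (i + 1) B)
    (hj' : ∀ s', σ i j < s' → s' ≤ s → ∀ u ≤ B, q j s' ≠ p (i + 1) u)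
    (hk' : ∀ t', σ i k < t' → t' ≤ t → ∀ u, A ≤ u → u ≤ n (i + 1) → q k t' ≠ p (i + 1) u) :
    A < B := by
  have hi' : i < r := by omega
  have hSk := hl.eq i hi' k hk
  have hSj := hl.eq i hi' j hj
  have h1 := hl.le_right i hi' k hk
  have h2 := hl.le_left i hi' k hk
  have h3 := hl.le_right i hi' j hj
  have h4 := hl.le_left i hi' j hj
  have hjk : j ≠ k := by rintro rfl; omega
  have hAB : A ≠ B := by
    rintro rfl
    exact hjk (h.disj_right j hj k hk s hsm t htm (eA.trans eB.symm))
  by_contra hcon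
  have hpi := h.isPath_left i hi'
  have hpi' := h.isPath_left (i + 1) hi
  have hpp : ∀ s ≤ n i, ∀ t ≤ n (i + 1), p i s ≠ p (i + 1) t := fun s hs t ht e => by
    have := h.disj_left i hi' (i + 1) hi s hs t ht e
    omega
  refine (h.crosses_swap i (i + 1) (by omega) hi).false
    (C := seg (p i) 0 (S i j) ∪ seg (q j) (σ i j) s ∪ seg (p (i + 1)) A (n (i + 1)))
    (D := seg (p (i + 1)) 0 B ∪ seg (q k) (σ i k) t ∪ seg (p i) (S i k) (n i))
    (Linked.trans (Linked.trans (v := p i (S i j)) ?_ ?_) (v := p (i + 1) A) ?_)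
    (Linked.trans (Linked.trans (v := p (i + 1) B) ?_ ?_) (v := p i (S i k)) ?_) ?_
  · exact (hpi.linked h4 le_rfl (by omega) (by omega) le_rfl).mono fun v hv => Or.inl (Or.inl hv)
  · rw [← hSj, ← eA]
    exact ((h.isPath_right j hj).linked hsm le_rfl (by omega) (by omega) le_rfl).mono
      fun v hv => Or.inl (Or.inr hv)
  · exact (hpi'.linked le_rfl le_rfl hA hA le_rfl).mono fun v hv => Or.inr hv
  · exact (hpi'.linked hB le_rfl (by omega) (by omega) le_rfl).mono fun v hv => Or.inl (Or.inl hv)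
  · rw [← hSk, ← eB]
    exact ((h.isPath_right k hk).linked htm (by omega) le_rfl le_rfl (by omega)).mono
      fun v hv => Or.inl (Or.inr hv)
  · exact (hpi.linked le_rfl le_rfl h2 h2 le_rfl).mono fun v hv => Or.inr hv
  · rintro v ((⟨x, hx, rfl⟩ | ⟨x, hx, rfl⟩) | ⟨x, hx, rfl⟩)
        ((⟨y, hy, e⟩ | ⟨y, hy, e⟩) | ⟨y, hy, e⟩) <;> rw [Set.mem_Icc] at hx hy
    · exact hpp x (by omega) y (by omega) e.symm
    · rcases eq_or_lt_of_le hy.1 with rfl | hy'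
      · have := hpi.inj _ _ (by omega) (by omega) (hSk.symm.trans e)
        omega
      · exact hl.last i hi' k hk y hy' (by omega) x (by omega) e
    · have := hpi.inj _ _ (by omega) (by omega) e
      omega
    · rcases eq_or_lt_of_le hx.1 with rfl | hx'
      · exact hpp _ h4 y (by omega) (hSj.symm.trans e.symm)
      · exact hj' x hx' hx.2 y hy.2 e.symm
    · exact hjk (h.disj_right j hj k hk x (by omega) y (by omega) e.symm)
    · rcases eq_or_lt_of_le hx.1 with rfl | hx'
      · have := hpi.inj _ _ (by omega) (by omega) (hSj.symm.trans e.symm)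
        omega
      · exact hl.last i hi' j hj x hx' (by omega) y (by omega) e.symm
    · have := hpi'.inj _ _ (by omega) (by omega) e
      omega
    · rcases eq_or_lt_of_le hy.1 with rfl | hy'
      · exact hpp _ h2 x (by omega) (hSk.symm.trans e)
      · exact hk' y hy' hy.2 x hx.1 hx.2 e
    · exact hpp y (by omega) x (by omega) e

/-- The first vertex of `q j` on `p i` after its last visit to `p (i - 1)` is
`q j (θ i j) = p i (T i j)`. -/
structure FirstTouch (r : ℕ) (p q : ℕ → ℕ → V) (n : ℕ → ℕ) (σ θ T : ℕ → ℕ → ℕ) : Prop where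
  level_le : ∀ i < r, ∀ j < r, level σ i j ≤ θ i j
  le_last : ∀ i < r, ∀ j < r, θ i j ≤ σ i j
  le_left : ∀ i < r, ∀ j < r, T i j ≤ n i
  eq : ∀ i < r, ∀ j < r, q j (θ i j) = p i (T i j)
  first : ∀ i < r, ∀ j < r, ∀ s, level σ i j ≤ s → s < θ i j → ∀ u ≤ n i, q j s ≠ p i u

theorem Weave.exists_firstTouch (h : Weave H r p q n m) (hl : LastTouch r p q n m σ S) :
    ∃ θ T, FirstTouch r p q n σ θ T := by
  classical
  have key : ∀ i j, i < r → j < r → ∃ s u, level σ i j ≤ s ∧ s ≤ σ i j ∧ u ≤ n i ∧ q j s = p i u ∧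
      ∀ s', level σ i j ≤ s' → s' < s → ∀ u ≤ n i, q j s' ≠ p i u := by
    intro i j hi hj
    have hw : level σ i j ≤ σ i j ∧ ∃ u ≤ n i, q j (σ i j) = p i u :=
      ⟨h.level_le hl hi hj, _, hl.le_left i hi j hj, hl.eq i hi j hj⟩
    have hex : ∃ s, level σ i j ≤ s ∧ ∃ u ≤ n i, q j s = p i u := ⟨_, hw⟩
    obtain ⟨h1, u, hu, e⟩ := Nat.find_spec hex
    exact ⟨_, u, h1, Nat.find_min' hex hw, hu, e, fun s' h2 h3 u hu e =>
      Nat.find_min hex h3 ⟨h2, u, hu, e⟩⟩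
  choose! θ T hθ using key
  exact ⟨θ, T, fun i hi j hj => (hθ i j hi hj).1, fun i hi j hj => (hθ i j hi hj).2.1,
    fun i hi j hj => (hθ i j hi hj).2.2.1, fun i hi j hj => (hθ i j hi hj).2.2.2.1,
    fun i hi j hj => (hθ i j hi hj).2.2.2.2⟩

variable {θ T : ℕ → ℕ → ℕ}

theorem Weave.avoid_between (h : Weave H r p q n m) (hl : LastTouch r p q n m σ S)
    (hf : FirstTouch r p q n σ θ T) {i i' j s : ℕ} (hi : i + 1 < r) (hi' : i' < r) (hj : j < r)
    (hs : σ i j < s) (hs' : s < θ (i + 1) j) : ∀ u ≤ n i', q j s ≠ p i' u := by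
  have h1 := hf.le_last _ hi j hj
  have h2 := hl.le_right _ hi j hj
  have hav : ∀ s', σ i j < s' → s' ≤ s → ∀ u ≤ n (i + 1), q j s' ≠ p (i + 1) u := fun s' h3 h4 =>
    hf.first _ hi j hj s' (by simpa [level] using h3) (by omega)
  rcases lt_trichotomy i' (i + 1) with hlt | rfl | hgt
  · refine hl.last i' hi' j hj s ?_ (by omega)
    have := h.last_le hl (show i' ≤ i by omega) (by omega) hj
    omega
  · exact hav s hs le_rfl
  · intro u hu e
    have hi0 : i < r := by omega
    have h3 := hl.le_left i hi0 j hj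
    have h4 := hl.eq i hi0 j hj
    refine (h.crosses_mid i (i + 1) i' (by omega) hgt hi').false
      (C := seg (p i) 0 (S i j) ∪ seg (q j) (σ i j) s ∪ seg (p i') u (n i'))
      (D := seg (p (i + 1)) 0 (n (i + 1)))
      (Linked.trans (Linked.trans (v := p i (S i j)) ?_ ?_) (v := p i' u) ?_)
      ((h.isPath_left _ hi).linked le_rfl le_rfl (by omega) (by omega) le_rfl) ?_
    · exact ((h.isPath_left i hi0).linked h3 le_rfl (by omega) (by omega) le_rfl).mono
        fun v hv => Or.inl (Or.inl hv)
    · rw [← h4, ← e]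
      exact ((h.isPath_right j hj).linked (by omega) le_rfl (by omega) (by omega) le_rfl).mono
        fun v hv => Or.inl (Or.inr hv)
    · exact ((h.isPath_left i' hi').linked le_rfl le_rfl hu hu le_rfl).mono
        fun v hv => Or.inr hv
    · rintro v ((⟨x, hx, rfl⟩ | ⟨x, hx, rfl⟩) | ⟨x, hx, rfl⟩) ⟨y, hy, e'⟩ <;>
        rw [Set.mem_Icc] at hx hy
      · have := h.disj_left _ hi i hi0 y hy.2 x (by omega) e'
        omega
      · rcases eq_or_lt_of_le hx.1 with rfl | hx'
        · have := h.disj_left _ hi i hi0 y hy.2 _ h3 (e'.trans h4)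
          omega
        · exact hav x hx' hx.2 y hy.2 e'.symm
      · have := h.disj_left _ hi i' hi' y hy.2 x hx.2 e'
        omega

theorem TightWeave.last_order (h : TightWeave H r p q n m) (hl : LastTouch r p q n m σ S)
    {i j k : ℕ} (hi : i < r) (hj : j < r) (hk : k < r) (hjk : S 0 j < S 0 k) :
    S i j < S i k := by
  induction i with
  | zero => exact hjk
  | succ i ih =>
    have hij := ih (by omega)
    have hne : j ≠ k := by rintro rfl; omega
    by_contra hcon
    refine hcon (h.rung_lt hl hi hj hk hij (h.last_lt hl (by omega) hi hj) (hl.le_right _ hi j hj)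
      (h.last_lt hl (by omega) hi hk) (hl.le_right _ hi k hk) (hl.le_left _ hi j hj)
      (hl.le_left _ hi k hk) (hl.eq _ hi j hj) (hl.eq _ hi k hk) ?_ ?_)
    · intro s h1 h2 u hu e
      have h3 := hl.le_left _ hi k hk
      have h4 := hl.le_right _ hi j hj
      have := h.touch_side hl hi hk hj hne.symm (by simpa [level] using h1) h2 (hu.trans h3) e
      have hu' : u ≠ S (i + 1) k := by
        rintro rfl
        exact hne (h.disj_right j hj k hk s (by omega) _ (hl.le_right _ hi k hk)
          (e.trans (hl.eq _ hi k hk).symm))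
      omega
    · intro t h1 h2 u hu hun e
      have h4 := hl.le_right _ hi k hk
      have := h.touch_side hl hi hj hk hne (by simpa [level] using h1) h2 hun e
      have h5 : S (i + 1) j ≠ S (i + 1) k := fun h6 =>
        hne (h.disj_right j hj k hk _ (hl.le_right _ hi j hj) _ (hl.le_right _ hi k hk)
          ((hl.eq _ hi j hj).trans ((congrArg _ h6).trans (hl.eq _ hi k hk).symm)))
      omega

theorem TightWeave.first_last_order (h : TightWeave H r p q n m) (hl : LastTouch r p q n m σ S)
    (hf : FirstTouch r p q n σ θ T) {i j k : ℕ} (hi : i < r) (hj : j < r) (hk : k < r)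
    (hjk : S 0 j < S 0 k) : T i j < S i k := by
  have hne : j ≠ k := by rintro rfl; omega
  exact (h.touch_side hl hi hk hj hne.symm (hf.level_le i hi j hj) (hf.le_last i hi j hj)
    (hf.le_left i hi j hj) (hf.eq i hi j hj)).2 (h.last_order hl hi hj hk hjk)

theorem TightWeave.last_first_order (h : TightWeave H r p q n m) (hl : LastTouch r p q n m σ S)
    (hf : FirstTouch r p q n σ θ T) {i j k : ℕ} (hi : i < r) (hj : j < r) (hk : k < r)
    (hjk : S 0 j < S 0 k) : S i j < T i k := by
  have hne : j ≠ k := by rintro rfl; omega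
  have h1 := h.touch_side hl hi hj hk hne (hf.level_le i hi k hk) (hf.le_last i hi k hk)
    (hf.le_left i hi k hk) (hf.eq i hi k hk)
  have h2 := h.last_order hl hi hj hk hjk
  have h3 : S i j ≠ T i k := fun h6 =>
    hne (h.disj_right j hj k hk _ (hl.le_right _ hi j hj) _
      ((hf.le_last i hi k hk).trans (hl.le_right _ hi k hk))
      ((hl.eq _ hi j hj).trans ((congrArg _ h6).trans (hf.eq _ hi k hk).symm)))
  omega

theorem TightWeave.first_order (h : TightWeave H r p q n m) (hl : LastTouch r p q n m σ S)
    (hf : FirstTouch r p q n σ θ T) {i j k : ℕ} (hi : i < r) (hj : j < r) (hk : k < r)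
    (hjk : S 0 j < S 0 k) : T i j < T i k := by
  rcases i with _ | i
  · have key : ∀ j < r, T 0 j = S 0 j := by
      intro j hj
      have h1 : θ 0 j = σ 0 j :=
        le_antisymm (hf.le_last 0 hi j hj) (by simpa [level] using hf.level_le 0 hi j hj)
      refine (h.isPath_left 0 hi).inj _ _ (hf.le_left 0 hi j hj) (hl.le_left 0 hi j hj) ?_
      rw [← hf.eq 0 hi j hj, h1, hl.eq 0 hi j hj]
    rw [key j hj, key k hk]
    exact hjk
  · have lev : ∀ j < r, σ i j < θ (i + 1) j := fun j hj => by
      simpa [level] using hf.level_le (i + 1) hi j hj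
    have le : ∀ j < r, θ (i + 1) j ≤ m j := fun j hj =>
      (hf.le_last _ hi j hj).trans (hl.le_right _ hi j hj)
    have hinj := (h.isPath_left _ hi).inj
    by_contra hcon
    refine hcon (h.rung_lt hl hi hj hk (h.last_order hl (by omega) hj hk hjk) (lev j hj) (le j hj)
      (lev k hk) (le k hk) (hf.le_left _ hi j hj) (hf.le_left _ hi k hk) (hf.eq _ hi j hj)
      (hf.eq _ hi k hk) ?_ ?_)
    all_goals
      have hne : j ≠ k := by rintro rfl; omega
      have h7 : T (i + 1) j ≠ T (i + 1) k := fun h6 =>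
        hne (h.disj_right j hj k hk _ (le j hj) _ (le k hk)
          ((hf.eq _ hi j hj).trans ((congrArg _ h6).trans (hf.eq _ hi k hk).symm)))
      have h8 := hf.le_left _ hi j hj
      have h9 := hf.le_left _ hi k hk
    · intro s h1 h2 u hu e
      rcases eq_or_lt_of_le h2 with rfl | h2
      · have := hinj _ _ (by omega) (by omega) ((hf.eq _ hi j hj).symm.trans e)
        omega
      · exact hf.first _ hi j hj s (by simpa [level] using h1) h2 u (by omega) e
    · intro s h1 h2 u hu hun e
      rcases eq_or_lt_of_le h2 with rfl | h2
      · have := hinj _ _ (by omega) (by omega) ((hf.eq _ hi k hk).symm.trans e)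
        omega
      · exact hf.first _ hi k hk s (by simpa [level] using h1) h2 u (by omega) e

end
section
variable {V : Type} {H : SimpleGraph V} {r : ℕ} {p q : ℕ → ℕ → V} {n m : ℕ → ℕ}
  {σ S θ T : ℕ → ℕ → ℕ}

theorem exists_strictMono_reindex (r : ℕ) (f : ℕ → ℕ)
    (hf : ∀ j < r, ∀ k < r, f j = f k → j = k) :
    ∃ e : ℕ → ℕ, (∀ j < r, e j < r) ∧ ∀ j k, j < k → k < r → f (e j) < f (e k) := by
  let g : Fin r → ℕ := fun j => f j
  have hg : Function.Injective g := fun j k h => Fin.ext (hf j j.2 k k.2 h)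
  have hmono : StrictMono (g ∘ Tuple.sort g) :=
    (Tuple.monotone_sort g).strictMono_of_injective (hg.comp (Tuple.sort g).injective)
  refine ⟨fun j => if h : j < r then Tuple.sort g ⟨j, h⟩ else j, fun j hj => ?_,
    fun j k hjk hk => ?_⟩
  · simp [hj]
  · have hj : j < r := by omega
    simpa [hj, hk] using hmono (show (⟨j, hj⟩ : Fin r) < ⟨k, hk⟩ from hjk)

theorem isMinorOf_mono {W : Type} {K : SimpleGraph W} {G : SimpleGraph V} (h : K.IsMinorOf H)
    (hHG : H ≤ G) : K.IsMinorOf G := by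
  obtain ⟨φ, h1, h2, h3⟩ := h
  refine ⟨φ, fun w => (h1 w).mono fun u v huv => hHG huv, h2, fun w w' hw => ?_⟩
  obtain ⟨u, hu, v, hv, huv⟩ := h3 w w' hw
  exact ⟨u, hu, v, hv, hHG huv⟩

/-- The branch set of the vertex `(i, j)` of the grid: a piece of the path `p i` together with
the part of `q j` leading to the path `p (i + 1)`. -/
def branchSet (r : ℕ) (p q : ℕ → ℕ → V) (hi σ θ : ℕ → ℕ → ℕ) (i j : ℕ) : Set V :=
  {v | ∃ t ≤ hi i j, (∀ k < j, hi i k < t) ∧ p i t = v} ∪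
    {v | i + 1 < r ∧ ∃ s, σ i j < s ∧ s < θ (i + 1) j ∧ q j s = v}

/-- Two families of disjoint paths which meet in a grid-like way yield a grid minor. -/
theorem gridGraph_isMinorOf_of_touch {hi : ℕ → ℕ → ℕ}
    (hp : ∀ i < r, IsPathOn H (p i) (n i)) (hq : ∀ j < r, IsPathOn H (q j) (m j))
    (dp : ∀ i < r, ∀ i' < r, ∀ s ≤ n i, ∀ t ≤ n i', p i s = p i' t → i = i')
    (dq : ∀ j < r, ∀ k < r, ∀ s ≤ m j, ∀ t ≤ m k, q j s = q k t → j = k)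
    (hhi : ∀ i < r, ∀ j < r, hi i j ≤ n i)
    (hσm : ∀ i < r, ∀ j < r, σ i j ≤ m j) (hθσ : ∀ i < r, ∀ j < r, θ i j ≤ σ i j)
    (hσ : ∀ i < r, ∀ j < r, q j (σ i j) = p i (S i j))
    (hθ : ∀ i < r, ∀ j < r, q j (θ i j) = p i (T i j))
    (hS : ∀ i < r, ∀ j < r, S i j ≤ hi i j) (hT : ∀ i < r, ∀ j < r, T i j ≤ hi i j)
    (hS' : ∀ i < r, ∀ j k, j < k → k < r → hi i j < S i k)
    (hT' : ∀ i < r, ∀ j k, j < k → k < r → hi i j < T i k)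
    (hlev : ∀ i j, i + 1 < r → j < r → σ i j < θ (i + 1) j)
    (hav : ∀ i j s, i + 1 < r → j < r → σ i j < s → s < θ (i + 1) j →
      ∀ i' < r, ∀ t ≤ n i', q j s ≠ p i' t) :
    (gridGraph r).IsMinorOf H := by
  have hhub : ∀ i < r, ∀ j < r, p i (S i j) ∈ branchSet r p q hi σ θ i j := fun i hir j hj =>
    Or.inl ⟨S i j, hS i hir j hj, fun k hk => hS' i hir k j hk hj, rfl⟩
  have hhi' : ∀ i < r, ∀ j k, j < k → k < r → hi i j < hi i k := fun i hir j k hjk hk =>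
    (hS' i hir j k hjk hk).trans_le (hS i hir k hk)
  have hmono : ∀ i i' j, i ≤ i' → i' < r → j < r → σ i j ≤ σ i' j := by
    intro i i' j hii'
    induction i', hii' using Nat.le_induction with
    | base => intros; rfl
    | succ i' h ih =>
      intro h1 h2
      have := ih (by omega) h2
      have := hlev i' j h1 h2
      have := hθσ (i' + 1) h1 j h2
      omega
  have hconn : ∀ i < r, ∀ j < r, ∀ v ∈ branchSet r p q hi σ θ i j,
      Linked H (branchSet r p q hi σ θ i j) (p i (S i j)) v := by
    rintro i hir j hj v (⟨t, ht, ht', rfl⟩ | ⟨hi1, s, hs, hs', rfl⟩)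
    · have hn := hhi i hir j hj
      have h1 := hS i hir j hj
      refine ((hp i hir).linked (lo := min (S i j) t) (hi := max (S i j) t) (by omega) (by omega)
        (by omega) (by omega) (by omega)).mono ?_
      rintro _ ⟨w, ⟨hw, hw'⟩, rfl⟩
      refine Or.inl ⟨w, by omega, fun k hk => ?_, rfl⟩
      have := ht' k hk
      have := hS' i hir k j hk hj
      omega
    · rw [← hσ i hir j hj]
      have h1 := hσm _ hi1 j hj
      have h2 := hθσ _ hi1 j hj
      refine ((hq j hj).linked (lo := σ i j) (hi := s) (by omega) (by omega)
        (by omega) (by omega) (by omega)).mono ?_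
      rintro _ ⟨w, ⟨hw, hw'⟩, rfl⟩
      rcases eq_or_lt_of_le hw with rfl | hw
      · rw [hσ i hir j hj]
        exact hhub i hir j hj
      · exact Or.inr ⟨hi1, w, hw, by omega, rfl⟩
  have hdisj : ∀ i < r, ∀ j < r, ∀ i' < r, ∀ j' < r, ∀ v ∈ branchSet r p q hi σ θ i j,
      v ∈ branchSet r p q hi σ θ i' j' → i = i' ∧ j = j' := by
    rintro i hir j hj i' hir' j' hj' v (⟨t, ht, ht', rfl⟩ | ⟨hi1, s, hs, hs', rfl⟩)
      (⟨u, hu, hu', e⟩ | ⟨hi2, w, hw, hw', e⟩)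
    · have h1 := hhi i hir j hj
      have h2 := hhi i' hir' j' hj'
      have := dp i' hir' i hir u (by omega) t (by omega) e
      subst this
      have := (hp i' hir').inj u t (by omega) (by omega) e
      subst this
      refine ⟨rfl, ?_⟩
      rcases lt_trichotomy j j' with h | h | h
      · have := hu' j h
        omega
      · exact h
      · have := ht' j' h
        omega
    · exact absurd e (hav i' j' w hi2 hj' hw hw' i hir t (ht.trans (hhi i hir j hj)))
    · exact absurd e.symm (hav i j s hi1 hj hs hs' i' hir' u (hu.trans (hhi i' hir' j' hj')))
    · have h1 := hσm _ hi1 j hj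
      have h2 := hθσ _ hi1 j hj
      have h3 := hσm _ hi2 j' hj'
      have h4 := hθσ _ hi2 j' hj'
      have := dq j' hj' j hj w (by omega) s (by omega) e
      subst this
      have := (hq j' hj').inj w s (by omega) (by omega) e
      subst this
      refine ⟨?_, rfl⟩
      rcases lt_trichotomy i i' with h | h | h
      · have := hmono (i + 1) i' j' h hir' hj'
        omega
      · exact h
      · have := hmono (i' + 1) i j' h hir hj'
        omega
  have hright : ∀ i < r, ∀ j, j + 1 < r → ∃ u ∈ branchSet r p q hi σ θ i j,
      ∃ v ∈ branchSet r p q hi σ θ i (j + 1), H.Adj u v := by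
    intro i hir j hj
    have h1 := hhi' i hir j (j + 1) (by omega) hj
    have h2 := hhi i hir (j + 1) hj
    refine ⟨p i (hi i j), Or.inl ⟨_, le_rfl, fun k hk => hhi' i hir k j hk (by omega), rfl⟩,
      p i (hi i j + 1), Or.inl ⟨_, h1, fun k hk => ?_, rfl⟩, (hp i hir).adj _ (by omega)⟩
    rcases eq_or_lt_of_le (Nat.lt_succ_iff.1 hk) with rfl | hk
    · omega
    · have := hhi' i hir k j hk (by omega)
      omega
  have hdown : ∀ i j, i + 1 < r → j < r → ∃ u ∈ branchSet r p q hi σ θ i j,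
      ∃ v ∈ branchSet r p q hi σ θ (i + 1) j, H.Adj u v := by
    intro i j hi1 hj
    have h1 := hlev i j hi1 hj
    have h2 := hσm _ hi1 j hj
    have h3 := hθσ _ hi1 j hj
    refine ⟨q j (θ (i + 1) j - 1), ?_, q j (θ (i + 1) j), ?_, ?_⟩
    · by_cases h : θ (i + 1) j - 1 = σ i j
      · rw [h, hσ i (by omega) j hj]
        exact hhub i (by omega) j hj
      · exact Or.inr ⟨hi1, _, by omega, by omega, rfl⟩
    · rw [hθ _ hi1 j hj]
      exact Or.inl ⟨_, hT _ hi1 j hj, fun k hk => hT' _ hi1 k j hk hj, rfl⟩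
    · have := (hq j hj).adj (θ (i + 1) j - 1) (by omega)
      rwa [show θ (i + 1) j - 1 + 1 = θ (i + 1) j by omega] at this
  refine ⟨fun w => branchSet r p q hi σ θ w.1 w.2, fun w => ?_, fun w w' hne => ?_,
    fun w w' hw => ?_⟩
  · rw [connected_induce_iff]
    exact ⟨⟨_, hhub _ w.1.2 _ w.2.2⟩, fun u hu v hv =>
      (hconn _ w.1.2 _ w.2.2 u hu).symm.trans (hconn _ w.1.2 _ w.2.2 v hv)⟩
  · rw [Set.disjoint_left]
    intro v hv hv'
    obtain ⟨h1, h2⟩ := hdisj _ w.1.2 _ w.2.2 _ w'.1.2 _ w'.2.2 v hv hv'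
    exact hne (Prod.ext (Fin.ext h1) (Fin.ext h2))
  · obtain ⟨⟨i, hir⟩, ⟨j, hj⟩⟩ := w
    obtain ⟨⟨i', hir'⟩, ⟨j', hj'⟩⟩ := w'
    simp only [gridGraph, boxProd_adj, pathGraph_adj, Fin.mk.injEq] at hw ⊢
    rcases hw with ⟨h | h, rfl⟩ | ⟨h | h, rfl⟩
    · subst h
      exact hdown i j hir' hj
    · subst h
      obtain ⟨u, hu, v, hv, huv⟩ := hdown i' j hir hj
      exact ⟨v, hv, u, hu, huv.symm⟩
    · subst h
      exact hright i hir j hj'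
    · subst h
      obtain ⟨u, hu, v, hv, huv⟩ := hright i hir j' hj
      exact ⟨v, hv, u, hu, huv.symm⟩

theorem Weave.gridGraph_isMinorOf [Finite V] (h : Weave H r p q n m) :
    (gridGraph r).IsMinorOf H := by
  obtain ⟨p, n, h⟩ := h.exists_tight
  obtain ⟨σ, S, hl⟩ := h.exists_lastTouch
  obtain ⟨θ, T, hf⟩ := h.exists_firstTouch hl
  rcases Nat.eq_zero_or_pos r with rfl | hr
  · exact ⟨fun w => w.1.elim0, fun w => w.1.elim0, fun w => w.1.elim0, fun w => w.1.elim0⟩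
  obtain ⟨e, he, hmono⟩ := exists_strictMono_reindex r (S 0) fun j hj k hk hjk =>
    h.disj_right j hj k hk _ (hl.le_right 0 hr j hj) _ (hl.le_right 0 hr k hk)
      ((hl.eq 0 hr j hj).trans ((congrArg _ hjk).trans (hl.eq 0 hr k hk).symm))
  have he' : ∀ j < r, ∀ k < r, e j = e k → j = k := by
    intro j hj k hk hjk
    rcases lt_trichotomy j k with h | h | h
    · have := hmono j k h hk
      rw [hjk] at this
      omega
    · exact h
    · have := hmono k j h hj
      rw [hjk] at this
      omega
  refine gridGraph_isMinorOf_of_touch (q := fun j => q (e j)) (m := fun j => m (e j))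
    (σ := fun i j => σ i (e j)) (S := fun i j => S i (e j)) (θ := fun i j => θ i (e j))
    (T := fun i j => T i (e j)) (hi := fun i j => max (S i (e j)) (T i (e j)))
    h.isPath_left (fun j hj => h.isPath_right _ (he j hj)) h.disj_left
    (fun j hj k hk s hs t ht hst => he' j hj k hk
      (h.disj_right _ (he j hj) _ (he k hk) s hs t ht hst))
    (fun i hi j hj => max_le (hl.le_left i hi _ (he j hj)) (hf.le_left i hi _ (he j hj)))
    (fun i hi j hj => hl.le_right i hi _ (he j hj))
    (fun i hi j hj => hf.le_last i hi _ (he j hj))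
    (fun i hi j hj => hl.eq i hi _ (he j hj))
    (fun i hi j hj => hf.eq i hi _ (he j hj))
    (fun i hi j hj => le_max_left _ _) (fun i hi j hj => le_max_right _ _)
    (fun i hi j k hjk hk => max_lt ?_ ?_) (fun i hi j k hjk hk => max_lt ?_ ?_)
    (fun i j hi hj => by simpa [level] using hf.level_le (i + 1) hi _ (he j hj))
    (fun i j s hi hj hs hs' i' hi' => h.avoid_between hl hf hi hi' (he j hj) hs hs')
  all_goals
    have hj := he j (hjk.trans hk)
    have hk' := he k hk
    have hjk' := hmono j k hjk hk
  · exact h.last_order hl hi hj hk' hjk'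
  · exact h.first_last_order hl hf hi hj hk' hjk'
  · exact h.last_first_order hl hf hi hj hk' hjk'
  · exact h.first_order hl hf hi hj hk' hjk'

end
section
variable {V : Type} {H : SimpleGraph V} {r l : ℕ} {τ : Fin l → V}

theorem HasLinkage.exists_paths {I J : Set (Fin l)} (hr : 0 < r)
    (h : HasLinkage H (τ '' I) (τ '' J) r) :
    ∃ (α β : ℕ → Fin l) (p : ℕ → ℕ → V) (n : ℕ → ℕ),
      (∀ i i', i < i' → i' < r → α i < α i') ∧
      (∀ i < r, ∀ i' < r, ∀ s ≤ n i, ∀ t ≤ n i', p i s = p i' t → i = i') ∧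
      ∀ i < r, α i ∈ I ∧ β i ∈ J ∧ p i 0 = τ (α i) ∧ p i (n i) = τ (β i) ∧
        IsPathOn H (p i) (n i) := by
  obtain ⟨P, hP, hPl⟩ := h
  have hPl' : ∀ i, ∃ a ∈ I, ∃ b ∈ J, Linked H (P i) (τ a) (τ b) := fun i => by
    obtain ⟨_, ⟨a, ha, rfl⟩, _, ⟨b, hb, rfl⟩, hl⟩ := hPl i
    exact ⟨a, ha, b, hb, hl⟩
  choose α hα β hβ hl using hPl'
  choose n p hp0 hpn hadj hinj hmem using fun i => (hl i).exists_path
  have hdisj : ∀ i i', ∀ s ≤ n i, ∀ t ≤ n i', p i s = p i' t → i = i' := by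
    intro i i' s hs t ht e
    by_contra hne
    exact Set.disjoint_left.1 (hP i i' hne) (hmem i s hs) (e ▸ hmem i' t ht)
  have hαi : Function.Injective α := fun i i' e =>
    hdisj i i' 0 (Nat.zero_le _) 0 (Nat.zero_le _) (by rw [hp0, hp0, e])
  have hmono : StrictMono (α ∘ Tuple.sort α) :=
    (Tuple.monotone_sort α).strictMono_of_injective (hαi.comp (Tuple.sort α).injective)
  let f : ℕ → Fin r := fun i => Tuple.sort α (if h : i < r then ⟨i, h⟩ else ⟨0, hr⟩)
  have hf : ∀ i < r, ∀ i' < r, f i = f i' → i = i' := by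
    intro i hi i' hi' e
    have := (Tuple.sort α).injective e
    simpa [hi, hi'] using this
  refine ⟨α ∘ f, β ∘ f, p ∘ f, n ∘ f, fun i i' h1 h2 => ?_,
    fun i hi i' hi' s hs t ht e => hf i hi i' hi' (hdisj _ _ s hs t ht e),
    fun i hi => ⟨hα _, hβ _, hp0 _, hpn _, hadj _, hinj _⟩⟩
  have := hmono (show (⟨i, h1.trans h2⟩ : Fin r) < ⟨i', h2⟩ from h1)
  simpa [f, h2, h1.trans h2] using this

theorem CrossFree.gridGraph_isMinorOf [Finite V] (hcf : CrossFree H τ) (hl : 4 * r ≤ l)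
    (hlink : ∀ I J : Set (Fin l), r ≤ I.ncard → r ≤ J.ncard → HasLinkage H (τ '' I) (τ '' J) r) :
    (gridGraph r).IsMinorOf H := by
  rcases Nat.eq_zero_or_pos r with rfl | hr
  · exact ⟨fun w => w.1.elim0, fun w => w.1.elim0, fun w => w.1.elim0, fun w => w.1.elim0⟩
  have hcard : ∀ s, s + r ≤ l → r ≤ {i : Fin l | s ≤ i.val ∧ i.val < s + r}.ncard := by
    intro s hs
    let g : Fin r → Fin l := fun i => ⟨s + i, by omega⟩
    have hg : Function.Injective g := fun i j e => by
      have := congrArg Fin.val e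
      simp only [g] at this
      exact Fin.ext (by omega)
    have h1 : (Set.range g).ncard = r := by
      rw [← Set.image_univ, Set.ncard_image_of_injective _ hg, Set.ncard_univ, Nat.card_fin]
    refine h1.ge.trans (Set.ncard_le_ncard ?_ (Set.toFinite _))
    rintro _ ⟨i, rfl⟩
    exact ⟨by simp [g], by simp [g]⟩
  have L : ∀ s t, s + r ≤ l → t + r ≤ l → _ := fun s t hs ht =>
    (hlink _ _ (hcard s hs) (hcard t ht)).exists_paths hr
  obtain ⟨α, β, p, n, hα, hp, hpi⟩ := L 0 (2 * r) (by omega) (by omega)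
  obtain ⟨γ, δ, q, m, -, hq, hqi⟩ := L (3 * r) r (by omega) (by omega)
  simp only [Set.mem_ofPred_eq] at hpi hqi
  have hβ : ∀ i i', i < i' → i' < r → β i' < β i := by
    intro i i' h1 h2
    have h0 : i < r := h1.trans h2
    obtain ⟨ha, hb, e1, e2, hP⟩ := hpi i h0
    obtain ⟨ha', hb', e1', e2', hP'⟩ := hpi i' h2
    rcases lt_trichotomy (β i) (β i') with h | h | h
    · exfalso
      refine hcf (α i) (α i') (β i) (β i') (hα i i' h1 h2) (Fin.lt_def.2 (by omega)) h
        (seg (p i) 0 (n i)) (seg (p i') 0 (n i')) ?_ ?_ ?_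
      · rw [← e1, ← e2]
        exact hP.linked le_rfl le_rfl (by omega) (by omega) le_rfl
      · rw [← e1', ← e2']
        exact hP'.linked le_rfl le_rfl (by omega) (by omega) le_rfl
      · rw [Set.disjoint_left]
        rintro _ ⟨s, hs, rfl⟩ ⟨t, ht, e⟩
        have := hp i' h2 i h0 t ht.2 s hs.2 e
        omega
    · have := hp i h0 i' h2 _ le_rfl _ le_rfl (by rw [e2, e2', h])
      omega
    · exact h
  refine Weave.gridGraph_isMinorOf (p := p) (q := q) (n := n) (m := m)
    ⟨fun i hi => (hpi i hi).2.2.2.2, fun j hj => (hqi j hj).2.2.2.2, hp, hq, ?_, ?_, ?_, ?_⟩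
  · intro i i' j h1 h2 hj
    obtain ⟨ha, hb, e1, e2, -⟩ := hpi i (h1.trans h2)
    obtain ⟨ha', hb', e1', e2', -⟩ := hpi i' h2
    obtain ⟨hc, hd, f1, f2, -⟩ := hqi j hj
    rw [e1, f2, e1', e2']
    exact hcf _ _ _ _ (hα i i' h1 h2) (Fin.lt_def.2 (by omega)) (Fin.lt_def.2 (by omega))
  · intro i i' h1 h2
    obtain ⟨ha, hb, e1, e2, -⟩ := hpi i (h1.trans h2)
    obtain ⟨ha', hb', e1', e2', -⟩ := hpi i' h2
    rw [e1, e2', e1', e2]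
    exact hcf _ _ _ _ (hα i i' h1 h2) (Fin.lt_def.2 (by omega)) (hβ i i' h1 h2)
  · intro i hi j hj C D hC hD hCD
    obtain ⟨ha, hb, e1, e2, -⟩ := hpi i hi
    obtain ⟨hc, hd, f1, f2, -⟩ := hqi j hj
    rw [f1, f2] at hC
    rw [e1, e2] at hD
    exact hcf (α i) (δ j) (β i) (γ j) (Fin.lt_def.2 (by omega)) (Fin.lt_def.2 (by omega))
      (Fin.lt_def.2 (by omega)) D C hD hC.symm hCD.symm
  · intro i i' i'' h1 h2 h3
    obtain ⟨ha, hb, e1, e2, -⟩ := hpi i (by omega)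
    obtain ⟨ha', hb', e1', e2', -⟩ := hpi i' (by omega)
    obtain ⟨ha'', hb'', e1'', e2'', -⟩ := hpi i'' h3
    rw [e1, e2'', e1', e2']
    exact hcf _ _ _ _ (hα i i' h1 (by omega)) (Fin.lt_def.2 (by omega)) (hβ i' i'' h2 h3)

end

theorem gridGraph_treewidth_isMinorOf {V : Type} [Finite V] {G : SimpleGraph V}
    (hG : IsUnitDiskGraph G) {Δ : ℕ} (hΔ : ∀ v : V, (G.neighborSet v).ncard ≤ Δ) :
    (gridGraph (G.treewidth / (100 * Δ ^ 3))).IsMinorOf G := by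
  generalize hr : G.treewidth / (100 * Δ ^ 3) = r
  rcases Nat.eq_zero_or_pos r with rfl | hr0
  · exact ⟨fun w => w.1.elim0, fun w => w.1.elim0, fun w => w.1.elim0, fun w => w.1.elim0⟩
  have hΔ0 : 1 ≤ Δ := by
    rcases Nat.eq_zero_or_pos Δ with rfl | h
    · simp at hr; omega
    · exact h
  obtain ⟨H, x, y, hHG, hd, hloc⟩ := exists_planar_subgraph hG
  have hΔH : ∀ v, (H.neighborSet v).ncard ≤ Δ := fun v =>
    (Set.ncard_le_ncard (fun u hu => hHG hu) (Set.toFinite _)).trans (hΔ v)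
  by_cases hW : ∃ W : Set V, W.ncard = 17 * r + 4 * Δ ∧ ∀ A B, IsSep H A B →
      (A ∩ B).ncard ≤ 4 * r + Δ → (W \ A).ncard < 4 * r + Δ ∨ (W \ B).ncard < 4 * r + Δ
  · obtain ⟨W, hWc, hsep⟩ := hW
    obtain ⟨H', l, τ, hH', hl, hcf, hlink⟩ := exists_society hd hΔH hr0 W hWc hsep
    exact isMinorOf_mono (hcf.gridGraph_isMinorOf hl hlink) (hH'.trans hHG)
  · exfalso
    push Not at hW
    have hdec := rootedDec_of_forall_exists_sep H (4 * r + Δ) (17 * r + 4 * Δ) (by omega)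
      (fun W hWc => hW W hWc) Set.univ ∅ (Set.empty_subset _) (by simp)
    have htw : H.TreewidthLE (21 * r + 5 * Δ - 1) := by
      refine RootedDec.treewidthLE ?_
      rwa [show 21 * r + 5 * Δ - 1 + 1 = 17 * r + 4 * Δ + (4 * r + Δ) by omega]
    have hG' := treewidthLE_of_neighbor_linked (m := (21 * r + 5 * Δ) * (Δ + 1) - 1) hΔ hloc htw
      (by rw [show 21 * r + 5 * Δ - 1 + 1 = 21 * r + 5 * Δ by omega]; omega)
    have hle : G.treewidth ≤ (21 * r + 5 * Δ) * (Δ + 1) - 1 := Nat.sInf_le hG'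
    have hge : 100 * Δ ^ 3 * r ≤ G.treewidth := by
      rw [← hr]
      exact Nat.mul_div_le _ _
    have hpos : 0 < (21 * r + 5 * Δ) * (Δ + 1) := by positivity
    have : (21 * r + 5 * Δ) * (Δ + 1) ≤ 100 * Δ ^ 3 * r := by
      calc (21 * r + 5 * Δ) * (Δ + 1) ≤ (21 * r * Δ + 5 * Δ * r) * (Δ + Δ) := by
            gcongr ?_ * ?_
            · nlinarith
            · omega
        _ = 52 * (Δ ^ 2 * r) := by ring
        _ ≤ 100 * (Δ ^ 2 * r) * Δ := by nlinarith [Nat.zero_le (Δ ^ 2 * r)]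
        _ = 100 * Δ ^ 3 * r := by ring
    omega

end UDG

/-- Every unit disk graph `G` with maximum degree `Δ` contains a grid
of size `⌊tw(G)/(100Δ³)⌋ × ⌊tw(G)/(100Δ³)⌋` as a minor. -/
theorem unitDiskGraph_grid_minor
    {V : Type} [Fintype V] (G : SimpleGraph V) (hG : IsUnitDiskGraph G)
    (Δ : ℕ) (hΔ : ∀ v : V, (G.neighborSet v).ncard ≤ Δ) :
    (gridGraph (G.treewidth / (100 * Δ ^ 3))).IsMinorOf G :=
  UDG.gridGraph_treewidth_isMinorOf hG hΔ
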